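/- arXiv:2003.14232 — 3 statements merged into one kernel-verified Lean document; each statement's English description precedes it below -/
import Mathlib

section
/- Let K be a field of characteristic 0, S = K[x₁,…,xₙ] with a fixed term order ≺, and let I₁,…,I_m be ideals of S. Let A ⊂ K be a finitely generated ℤ-algebra containing the coefficients of fixed finite generating sets of I₁,…,I_m. Then there exists a prime number p₀ such that for every prime p > p₀ there is a minimal prime P of pA with lt(I_j(p)) = lt(I_j)(p) for all j = 1,…,m. -/
open MvPolynomial

/-- The leading exponent (degree) of a multivariate polynomial with respect to a
monomial order: the maximum of its support. -/
noncomputable def MonomialOrder.degreeOf {σ : Type*} {K : Type*} [CommSemiring K]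
    (m : MonomialOrder σ) (f : MvPolynomial σ K) : σ →₀ ℕ :=
  m.toSyn.symm (f.support.sup m.toSyn)

/-- The leading term `lt(f)` of a polynomial with respect to a monomial order. -/
noncomputable def MonomialOrder.leadTerm {σ : Type*} {K : Type*} [CommSemiring K]
    (m : MonomialOrder σ) (f : MvPolynomial σ K) : MvPolynomial σ K :=
  monomial (m.degreeOf f) (f.coeff (m.degreeOf f))

/-- The initial ideal `lt(I)` of an ideal, generated by leading terms of its
nonzero elements. -/
noncomputable def MonomialOrder.initialIdeal {σ : Type*} {K : Type*} [CommSemiring K]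
    (m : MonomialOrder σ) (I : Ideal (MvPolynomial σ K)) : Ideal (MvPolynomial σ K) :=
  Ideal.span { g | ∃ f ∈ I, f ≠ 0 ∧ g = m.leadTerm f }

/-- The leading term of `f` is a squarefree monomial. -/
def MonomialOrder.HasSqfreeLeadTerm {σ : Type*} {K : Type*} [CommSemiring K]
    (m : MonomialOrder σ) (f : MvPolynomial σ K) : Prop :=
  f ≠ 0 ∧ ∀ i, m.degreeOf f i ≤ 1

/-- The family `C_f` of Knutson ideals associated to `f` : the smallest family of ideals
containing `(f)`, closed under colon by arbitrary ideals, sums and intersections. -/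
inductive KnutsonFamily {σ : Type*} {K : Type*} [CommRing K] (f : MvPolynomial σ K) :
    Ideal (MvPolynomial σ K) → Prop
  | base : KnutsonFamily f (Ideal.span {f})
  | colon (I J : Ideal (MvPolynomial σ K)) : KnutsonFamily f I → KnutsonFamily f (I.colon J)
  | add (I J : Ideal (MvPolynomial σ K)) :
      KnutsonFamily f I → KnutsonFamily f J → KnutsonFamily f (I + J)
  | inter (I J : Ideal (MvPolynomial σ K)) :
      KnutsonFamily f I → KnutsonFamily f J → KnutsonFamily f (I ⊓ J)

/-- A squarefree monomial ideal : an ideal generated by squarefree monomials. -/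
def IsSqfreeMonomialIdeal {σ : Type*} {K : Type*} [CommSemiring K]
    (J : Ideal (MvPolynomial σ K)) : Prop :=
  ∃ G : Set (MvPolynomial σ K),
    (∀ g ∈ G, ∃ s : Finset σ, g = ∏ i ∈ s, X i) ∧ J = Ideal.span G

section ReductionModP

variable {n : ℕ} {K : Type*} [Field K]

/-- The inclusion `A[x₁,…,xₙ] → K[x₁,…,xₙ]` for a subalgebra `A ⊆ K`. -/
noncomputable def liftMap (A : Subalgebra ℤ K) :
    MvPolynomial (Fin n) ↥A →+* MvPolynomial (Fin n) K :=
  MvPolynomial.map (algebraMap ↥A K)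

/-- The reduction map `A[x₁,…,xₙ] → Frac(A/P)[x₁,…,xₙ]`. -/
noncomputable def redMap (A : Subalgebra ℤ K) (P : Ideal ↥A) :
    MvPolynomial (Fin n) ↥A →+* MvPolynomial (Fin n) (FractionRing (↥A ⧸ P)) :=
  MvPolynomial.map
    ((algebraMap (↥A ⧸ P) (FractionRing (↥A ⧸ P))).comp (Ideal.Quotient.mk P))

/-- The reduction `I(p)` of an ideal `I ⊆ K[x₁,…,xₙ]` : first contract to
`I' = I ∩ A[x₁,…,xₙ]`, then extend along `A[x₁,…,xₙ] → Frac(A/P)[x₁,…,xₙ]`. -/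
noncomputable def idealReduction (A : Subalgebra ℤ K) (P : Ideal ↥A)
    (I : Ideal (MvPolynomial (Fin n) K)) :
    Ideal (MvPolynomial (Fin n) (FractionRing (↥A ⧸ P))) :=
  Ideal.map (redMap A P) (Ideal.comap (liftMap A) I)

end ReductionModP

theorem exists_prime_avoid {A : Type*} [CommRing A] [IsDomain A] [CharZero A]
    [Algebra.FiniteType ℤ A] (a : A) (ha : a ≠ 0) :
    ∃ p₀ : ℕ, ∀ p : ℕ, p₀ < p → p.Prime →
      ∃ P ∈ (Ideal.span {(p : A)}).minimalPrimes, a ∉ P := by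
  have hfp : (algebraMap ℤ A).FinitePresentation :=
    RingHom.FinitePresentation.of_finiteType.mp
      ((RingHom.finiteType_algebraMap (A := ℤ) (B := A)).mpr inferInstance)
  have hs : Topology.IsConstructible
      (PrimeSpectrum.basicOpen a : Set (PrimeSpectrum A)) := by
    exact PrimeSpectrum.isRetrocompact_basicOpen.isConstructible
      (PrimeSpectrum.basicOpen a).isOpen
  obtain ⟨T, hT⟩ := PrimeSpectrum.exists_constructibleSetData_iff.mpr
    (PrimeSpectrum.isConstructible_comap_image hfp hs)
  have hbot : (⟨⊥, Ideal.isPrime_bot⟩ : PrimeSpectrum ℤ) ∈ T.toSet := by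
    rw [hT]
    refine ⟨⟨⊥, Ideal.isPrime_bot⟩, ?_, ?_⟩
    · simpa using ha
    · ext x
      simp
  simp only [PrimeSpectrum.ConstructibleSetData.toSet, Set.mem_iUnion] at hbot
  obtain ⟨C, hC, hb⟩ := hbot
  simp only [PrimeSpectrum.BasicConstructibleSetData.toSet, Set.mem_sdiff,
    PrimeSpectrum.mem_zeroLocus, Set.singleton_subset_iff] at hb
  obtain ⟨h1, h2⟩ := hb
  have hf : C.f ≠ 0 := by simpa using h2
  refine ⟨C.f.natAbs, fun p hp hpp => ?_⟩
  have hpZ : Prime (p : ℤ) := Nat.prime_iff_prime_int.mp hpp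
  have hprime : (Ideal.span {(p : ℤ)}).IsPrime :=
    (Ideal.span_singleton_prime hpZ.ne_zero).mpr hpZ
  have hmem : (⟨Ideal.span {(p : ℤ)}, hprime⟩ : PrimeSpectrum ℤ) ∈ T.toSet := by
    simp only [PrimeSpectrum.ConstructibleSetData.toSet, Set.mem_iUnion]
    refine ⟨C, hC, ?_⟩
    simp only [PrimeSpectrum.BasicConstructibleSetData.toSet, Set.mem_sdiff,
      PrimeSpectrum.mem_zeroLocus, Set.singleton_subset_iff]
    constructor
    · intro x hx
      have h3 := h1 hx
      simp only [SetLike.mem_coe, Ideal.mem_bot] at h3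
      rw [h3]
      exact zero_mem _
    · intro h
      have h4 := Ideal.mem_span_singleton.mp h
      have h5 := Int.natAbs_dvd_natAbs.mpr h4
      have h6 := Nat.le_of_dvd (Int.natAbs_pos.mpr hf) h5
      simp at h6
      omega
  rw [hT] at hmem
  obtain ⟨Q, hQa, hQ⟩ := hmem
  have hle : Ideal.span {(p : A)} ≤ Q.asIdeal := by
    rw [Ideal.span_singleton_le_iff_mem]
    have h7 : (p : ℤ) ∈ (PrimeSpectrum.comap (algebraMap ℤ A) Q).asIdeal := by
      rw [hQ]; exact Ideal.mem_span_singleton_self _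
    simpa using h7
  have := Q.isPrime
  obtain ⟨P, hP, hPQ⟩ := Ideal.exists_minimalPrimes_le hle
  exact ⟨P, hP, fun h => hQa (hPQ h)⟩

/-- `d` is the leading exponent of the (nonzero) polynomial `f`. -/
def IsLead {σ R : Type*} [CommSemiring R] (m : MonomialOrder σ) (f : MvPolynomial σ R)
    (d : σ →₀ ℕ) : Prop :=
  coeff d f ≠ 0 ∧ ∀ e, coeff e f ≠ 0 → m.toSyn e ≤ m.toSyn d

/-- The set of leading exponents of an ideal. -/
def leadSet {σ R : Type*} [CommSemiring R] (m : MonomialOrder σ)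
    (I : Ideal (MvPolynomial σ R)) : Set (σ →₀ ℕ) :=
  {d | ∃ f ∈ I, IsLead m f d}

theorem isLead_degreeOf {σ R : Type*} [CommSemiring R] (m : MonomialOrder σ)
    (f : MvPolynomial σ R) (hf : f ≠ 0) : IsLead m f (m.degreeOf f) := by
  constructor
  · exact m.coeff_degree_ne_zero_iff.mpr hf
  · intro e he
    exact m.le_degree (mem_support_iff.mpr he)

theorem IsLead.ne_zero {σ R : Type*} [CommSemiring R] {m : MonomialOrder σ}
    {f : MvPolynomial σ R} {d : σ →₀ ℕ} (h : IsLead m f d) : f ≠ 0 := by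
  rintro rfl
  exact h.1 (by simp)

theorem IsLead.unique {σ R : Type*} [CommSemiring R] {m : MonomialOrder σ}
    {f : MvPolynomial σ R} {d e : σ →₀ ℕ} (h : IsLead m f d) (h' : IsLead m f e) : d = e :=
  m.toSyn.injective (le_antisymm (h'.2 _ h.1) (h.2 _ h'.1))

theorem initialIdeal_eq {σ F : Type*} [Field F] (m : MonomialOrder σ)
    (I : Ideal (MvPolynomial σ F)) :
    m.initialIdeal I = Ideal.span ((fun s => monomial s (1 : F)) '' leadSet m I) := by
  apply le_antisymm
  · refine Ideal.span_le.mpr ?_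
    rintro g ⟨f, hf, hf0, rfl⟩
    have : m.leadTerm f = C (f.coeff (m.degreeOf f)) * monomial (m.degreeOf f) (1 : F) := by
      rw [MonomialOrder.leadTerm, C_mul_monomial, mul_one]
    rw [this]
    exact Ideal.mul_mem_left _ _ (Ideal.subset_span ⟨_, ⟨f, hf, isLead_degreeOf m f hf0⟩, rfl⟩)
  · refine Ideal.span_le.mpr ?_
    rintro g ⟨d, ⟨f, hf, hd⟩, rfl⟩
    have hdd := hd.unique (isLead_degreeOf m f hd.ne_zero)
    have : monomial d (1 : F) = C (f.coeff d)⁻¹ * m.leadTerm f := by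
      rw [MonomialOrder.leadTerm, ← hdd, C_mul_monomial, inv_mul_cancel₀ hd.1]
    show monomial d (1 : F) ∈ _
    rw [this]
    exact Ideal.mul_mem_left _ _ (Ideal.subset_span ⟨f, hf, hd.ne_zero, rfl⟩)

theorem coeff_monomial_mul_ne {σ R : Type*} [CommSemiring R] {b e : σ →₀ ℕ} {c : R}
    {f : MvPolynomial σ R} (h : coeff e (monomial b c * f) ≠ 0) :
    ∃ e', e = b + e' ∧ coeff e' f ≠ 0 := by
  classical
  rw [coeff_monomial_mul'] at h
  split_ifs at h with hb
  · refine ⟨e - b, (add_tsub_cancel_of_le hb).symm, right_ne_zero_of_mul h⟩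
  · exact absurd rfl h

theorem IsLead.monomial_mul {σ R : Type*} [CommSemiring R] [NoZeroDivisors R]
    {m : MonomialOrder σ}
    {f : MvPolynomial σ R} {d : σ →₀ ℕ} (h : IsLead m f d) (b : σ →₀ ℕ) (c : R) (hc : c ≠ 0) :
    IsLead m (monomial b c * f) (b + d) := by
  constructor
  · rw [coeff_monomial_mul]
    exact mul_ne_zero hc h.1
  · intro e he
    obtain ⟨e', rfl, he'⟩ := coeff_monomial_mul_ne he
    simpa using h.2 _ he'

theorem leadSet_upper {σ R : Type*} [CommSemiring R] [NoZeroDivisors R] [Nontrivial R]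
    (m : MonomialOrder σ)
    (I : Ideal (MvPolynomial σ R)) {d e : σ →₀ ℕ} (hd : d ∈ leadSet m I) (h : d ≤ e) :
    e ∈ leadSet m I := by
  obtain ⟨f, hf, hl⟩ := hd
  obtain ⟨b, rfl⟩ := exists_add_of_le h
  refine ⟨monomial b 1 * f, Ideal.mul_mem_left _ _ hf, ?_⟩
  rw [add_comm]
  exact hl.monomial_mul b 1 one_ne_zero

/-- Dickson's lemma: uniform leading coefficient. -/
theorem exists_uniform {n : ℕ} {A : Type*} [CommRing A] [IsDomain A] (m : MonomialOrder (Fin n))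
    (I' : Ideal (MvPolynomial (Fin n) A)) :
    ∃ a : A, a ≠ 0 ∧ ∀ d ∈ leadSet m I', ∃ g ∈ I', IsLead m g d ∧ coeff d g = a := by
  classical
  set S := leadSet m I' with hS
  have hanti : IsAntichain (· ≤ ·) {d | Minimal (· ∈ S) d} := setOfPred_minimal_antichain _
  have hfin : {d | Minimal (· ∈ S) d}.Finite := WellQuasiOrderedLE.finite_of_isAntichain hanti
  have hch : ∀ d, ∃ g ∈ I', d ∈ S → IsLead m g d := by
    intro d
    by_cases hd : d ∈ S
    · obtain ⟨f, hf, hl⟩ := hd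
      exact ⟨f, hf, fun _ => hl⟩
    · exact ⟨0, zero_mem _, fun h => absurd h hd⟩
  choose g hgI hgl using hch
  refine ⟨∏ d ∈ hfin.toFinset, coeff d (g d), ?_, ?_⟩
  · refine Finset.prod_ne_zero_iff.mpr fun d hd => ?_
    exact (hgl d ((hfin.mem_toFinset.mp hd).prop)).1
  · intro e he
    obtain ⟨d, hde, hd⟩ := exists_minimal_le_of_wellFoundedLT (· ∈ S) e he
    obtain ⟨b, rfl⟩ := exists_add_of_le hde
    have hdf : d ∈ hfin.toFinset := hfin.mem_toFinset.mpr hd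
    have hl := hgl d hd.prop
    refine ⟨monomial b (∏ x ∈ hfin.toFinset.erase d, coeff x (g x)) * g d,
      Ideal.mul_mem_left _ _ (hgI d), ?_, ?_⟩
    · rw [add_comm]
      refine hl.monomial_mul b _ ?_
      refine Finset.prod_ne_zero_iff.mpr fun x hx => ?_
      exact (hgl x ((hfin.mem_toFinset.mp (Finset.mem_of_mem_erase hx)).prop)).1
    · rw [add_comm d b, coeff_monomial_mul, Finset.prod_erase_mul _ _ hdf]

/-- Division with remainder over `A`, staying inside an ideal `Q` of coefficients. -/
theorem division {σ : Type*} {A : Type*} [CommRing A] (m : MonomialOrder σ)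
    (I' : Ideal (MvPolynomial σ A)) (S : Set (σ →₀ ℕ)) (a : A)
    (hg : ∀ d ∈ S, ∃ g ∈ I', IsLead m g d ∧ coeff d g = a) (Q : Ideal A) :
    ∀ (D : WithTop m.syn) (h : MvPolynomial σ A), (∀ e, coeff e h ∈ Q) →
      (∀ e, coeff e h ≠ 0 → (m.toSyn e : WithTop m.syn) < D) →
      ∃ (N : ℕ) (r : MvPolynomial σ A), C (a ^ N) * h - r ∈ I' ∧ (∀ e ∈ S, coeff e r = 0) ∧
        (∀ e, coeff e r ∈ Q) ∧ (∀ e, coeff e r ≠ 0 → (m.toSyn e : WithTop m.syn) < D) := by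
  classical
  intro D
  induction D using WellFoundedLT.induction with
  | ind D ih =>
  intro h hQ hD
  by_cases h0 : h = 0
  · exact ⟨0, 0, by simp [h0], by simp, by simp, by simp⟩
  obtain ⟨hd1, hd2⟩ := isLead_degreeOf m h h0
  set d := m.degreeOf h with hd
  have hdD := hD d hd1
  by_cases hdS : d ∈ S
  · obtain ⟨g, hgI, hgl, hga⟩ := hg d hdS
    have key : ∀ e, coeff e (C a * h - C (coeff d h) * g) = a * coeff e h - coeff d h * coeff e g := by
      intro e
      simp [coeff_C_mul]
    obtain ⟨N, r, h1, h2, h3, h4⟩ := ih _ hdD (C a * h - C (coeff d h) * g)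
      (fun e => by
        rw [key]
        exact Q.sub_mem (Q.mul_mem_left _ (hQ e)) (Q.mul_mem_right _ (hQ d)))
      (fun e he => by
        rw [key] at he
        rw [WithTop.coe_lt_coe]
        refine lt_of_le_of_ne ?_ ?_
        · by_cases he1 : coeff e h = 0
          · refine hgl.2 _ fun he2 => he (by rw [he1, he2]; simp)
          · exact hd2 _ he1
        · intro hed
          have := m.toSyn.injective hed
          subst this
          apply he
          rw [hga]; ring)
    refine ⟨N + 1, r, ?_, h2, h3, fun e he => (h4 e he).trans hdD⟩
    have : C (a ^ (N + 1)) * h - r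
        = (C (a ^ N) * (C a * h - C (coeff d h) * g) - r) + C (a ^ N) * C (coeff d h) * g := by
      rw [pow_succ, C_mul]; ring
    rw [this]
    exact I'.add_mem h1 (I'.mul_mem_left _ hgI)
  · have key : ∀ e, coeff e (h - monomial d (coeff d h)) = if d = e then 0 else coeff e h := by
      intro e
      rw [coeff_sub, coeff_monomial]
      split_ifs with hde
      · rw [hde]; simp
      · simp
    obtain ⟨N, r, h1, h2, h3, h4⟩ := ih _ hdD (h - monomial d (coeff d h))
      (fun e => by
        rw [key]
        split_ifs
        · exact zero_mem _
        · exact hQ e)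
      (fun e he => by
        rw [key] at he
        split_ifs at he with hde
        · exact absurd rfl he
        · rw [WithTop.coe_lt_coe]
          exact lt_of_le_of_ne (hd2 _ he) fun hh => hde (m.toSyn.injective hh).symm)
    refine ⟨N, r + monomial d (a ^ N * coeff d h), ?_, ?_, ?_, ?_⟩
    · have : C (a ^ N) * h - (r + monomial d (a ^ N * coeff d h))
        = C (a ^ N) * (h - monomial d (coeff d h)) - r := by
        rw [mul_sub, C_mul_monomial]; ring
      rw [this]
      exact h1
    · intro e he
      rw [coeff_add, h2 e he, coeff_monomial, if_neg, zero_add]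
      rintro rfl
      exact hdS he
    · intro e
      rw [coeff_add, coeff_monomial]
      refine Q.add_mem (h3 e) ?_
      split_ifs
      · exact Q.mul_mem_left _ (hQ d)
      · exact zero_mem _
    · intro e he
      rw [coeff_add, coeff_monomial] at he
      by_cases hde : d = e
      · rw [← hde]; exact hdD
      · rw [if_neg hde, add_zero] at he
        exact (h4 e he).trans hdD

/-- Main point: leading exponents modulo `P` are leading exponents of the ideal. -/
theorem lead_mod {σ : Type*} {A : Type*} [CommRing A] (m : MonomialOrder σ)
    (I' : Ideal (MvPolynomial σ A)) (a : A)
    (hg : ∀ d ∈ leadSet m I', ∃ g ∈ I', IsLead m g d ∧ coeff d g = a)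
    (P : Ideal A) [hP : P.IsPrime] (haP : a ∉ P)
    (h : MvPolynomial σ A) (hh : h ∈ I') (d : σ →₀ ℕ) (hd : coeff d h ∉ P)
    (hmax : ∀ e, coeff e h ∉ P → m.toSyn e ≤ m.toSyn d) : d ∈ leadSet m I' := by
  classical
  by_contra hdS
  have hsat : ∀ r ∈ I', (∀ e ∈ leadSet m I', coeff e r = 0) → r = 0 := by
    intro r hr hr'
    by_contra hr0
    have hl := isLead_degreeOf m r hr0
    exact hl.1 (hr' _ ⟨r, hr, hl⟩)
  let h1 : MvPolynomial σ A :=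
    ∑ e ∈ h.support.filter (fun e => m.toSyn e < m.toSyn d), monomial e (coeff e h)
  have hc1 : ∀ e, coeff e h1 = if m.toSyn e < m.toSyn d then coeff e h else 0 := by
    intro e
    simp only [h1, coeff_sum, coeff_monomial, Finset.sum_ite_eq', Finset.mem_filter,
      mem_support_iff]
    by_cases he : coeff e h = 0 <;> simp [he]
  let h2 : MvPolynomial σ A := h - monomial d (coeff d h) - h1
  have hc2 : ∀ e, coeff e h2 ∈ P := by
    intro e
    simp only [h2, coeff_sub, coeff_monomial, hc1]
    rcases lt_trichotomy (m.toSyn e) (m.toSyn d) with hlt | heq | hgt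
    · have : d ≠ e := by rintro rfl; exact lt_irrefl _ hlt
      simp [hlt, this]
    · have := m.toSyn.injective heq
      subst this
      simp
    · have : d ≠ e := by rintro rfl; exact lt_irrefl _ hgt
      rw [if_neg this, if_neg (not_lt.mpr hgt.le)]
      simp only [sub_zero]
      by_contra hcon
      exact absurd (hmax e hcon) (not_le.mpr hgt)
  obtain ⟨N1, r1, a1, b1, -, d1⟩ := division m I' _ a hg ⊤ (m.toSyn d : WithTop m.syn) h1
    (fun e => Submodule.mem_top)
    (fun e he => by
      rw [hc1] at he
      split_ifs at he with hlt
      · exact WithTop.coe_lt_coe.mpr hlt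
      · exact absurd rfl he)
  obtain ⟨N2, r2, a2, b2, c2, -⟩ := division m I' _ a hg P ⊤ h2 hc2
    (fun e he => WithTop.coe_lt_top _)
  have hr1 : coeff d r1 = 0 := by
    by_contra hcon
    exact lt_irrefl _ (d1 d hcon)
  let r : MvPolynomial σ A := monomial d (a ^ (N1 + N2) * coeff d h) + C (a ^ N2) * r1
    + C (a ^ N1) * r2
  have hrI : r ∈ I' := by
    have : r = C (a ^ (N1 + N2)) * h - C (a ^ N2) * (C (a ^ N1) * h1 - r1)
        - C (a ^ N1) * (C (a ^ N2) * h2 - r2) := by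
      simp only [r, h2, ← C_mul_monomial, pow_add, C_mul]
      ring
    rw [this]
    exact I'.sub_mem (I'.sub_mem (I'.mul_mem_left _ hh) (I'.mul_mem_left _ a1))
      (I'.mul_mem_left _ a2)
  have hr0 := hsat r hrI (fun e he => by
    have : d ≠ e := by rintro rfl; exact hdS he
    simp [-map_pow, -C_pow, r, coeff_monomial, coeff_C_mul, this, b1 e he, b2 e he])
  have hcd : a ^ (N1 + N2) * coeff d h + a ^ N1 * coeff d r2 = 0 := by
    have := congrArg (coeff d) hr0
    simpa [-map_pow, -C_pow, r, coeff_monomial, coeff_C_mul, hr1] using this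
  have : a ^ (N1 + N2) * coeff d h ∈ P := by
    rw [eq_neg_of_add_eq_zero_left hcd]
    exact P.neg_mem (P.mul_mem_left _ (c2 d))
  rcases hP.mem_or_mem this with h' | h'
  · exact haP (hP.mem_of_pow_mem _ h')
  · exact hd h'

section
attribute [local instance] FractionRing.liftAlgebra

/-- Elements of `I` generated over `A` are `K`-combinations of elements of the contraction. -/
theorem mem_span_comap {n : ℕ} {K : Type*} [Field K] (A : Subalgebra ℤ K)
    (I : Ideal (MvPolynomial (Fin n) K)) (G : Finset (MvPolynomial (Fin n) K))
    (hGI : I = Ideal.span (G : Set (MvPolynomial (Fin n) K)))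
    (hGA : ∀ g ∈ G, ∀ d, MvPolynomial.coeff d g ∈ A)
    (f : MvPolynomial (Fin n) K) (hf : f ∈ I) :
    f ∈ Submodule.span K (liftMap A '' (Ideal.comap (liftMap A) I : Set _)) := by
  have hmul : ∀ p x : MvPolynomial (Fin n) K,
      x ∈ Submodule.span K (liftMap A '' (Ideal.comap (liftMap A) I : Set _)) →
      p * x ∈ Submodule.span K (liftMap A '' (Ideal.comap (liftMap A) I : Set _)) := by
    intro p
    induction p using MvPolynomial.induction_on with
    | C c =>
      intro x hx
      rw [← smul_eq_C_mul]
      exact Submodule.smul_mem _ _ hx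
    | add p q hp hq =>
      intro x hx
      rw [add_mul]
      exact Submodule.add_mem _ (hp x hx) (hq x hx)
    | mul_X p i hp =>
      intro x hx
      rw [mul_assoc]
      apply hp
      induction hx using Submodule.span_induction with
      | mem x hx =>
        obtain ⟨u, hu, rfl⟩ := hx
        refine Submodule.subset_span ⟨X i * u, Ideal.mul_mem_left _ _ hu, ?_⟩
        simp [liftMap]
      | zero => simp
      | add x y _ _ hx hy =>
        rw [mul_add]
        exact Submodule.add_mem _ hx hy
      | smul c x _ hx =>
        rw [mul_smul_comm]
        exact Submodule.smul_mem _ _ hx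
  have hf' := hf
  rw [hGI] at hf'
  induction hf' using Submodule.span_induction with
  | mem x hx =>
    have hx' : x ∈ I := by rw [hGI]; exact Ideal.subset_span hx
    have : x ∈ Set.range (MvPolynomial.map (σ := Fin n) (algebraMap A K)) := by
      rw [MvPolynomial.mem_range_map_iff_coeffs_subset]
      intro c hc
      obtain ⟨d, -, rfl⟩ := MvPolynomial.mem_coeffs_iff.mp hc
      exact ⟨⟨_, hGA x hx d⟩, rfl⟩
    obtain ⟨u, rfl⟩ := this
    exact Submodule.subset_span ⟨u, hx', rfl⟩
  | zero => simp
  | add x y hx hy h1 h2 =>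
    have hx : x ∈ I := by rw [hGI]; exact hx
    have hy : y ∈ I := by rw [hGI]; exact hy
    exact Submodule.add_mem _ (h1 hx) (h2 hy)
  | smul p x hx h1 =>
    have hx : x ∈ I := by rw [hGI]; exact hx
    exact hmul p x (h1 hx)

theorem leadSet_comap {n : ℕ} {K : Type*} [Field K] (m : MonomialOrder (Fin n))
    (A : Subalgebra ℤ K)
    (I : Ideal (MvPolynomial (Fin n) K)) (G : Finset (MvPolynomial (Fin n) K))
    (hGI : I = Ideal.span (G : Set (MvPolynomial (Fin n) K)))
    (hGA : ∀ g ∈ G, ∀ d, MvPolynomial.coeff d g ∈ A) :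
    leadSet m (Ideal.comap (liftMap A) I) = leadSet m I := by
  have hinj : Function.Injective (algebraMap A K) := Subtype.val_injective
  apply Set.Subset.antisymm
  · rintro d ⟨f, hf, hd⟩
    refine ⟨liftMap A f, hf, ?_, ?_⟩
    · rw [liftMap, coeff_map]
      exact (map_ne_zero_iff _ hinj).mpr hd.1
    · intro e he
      rw [liftMap, coeff_map] at he
      exact hd.2 e ((map_ne_zero_iff _ hinj).mp he)
  · rintro d ⟨f, hf, hd⟩
    have hsp := mem_span_comap A I G hGI hGA f hf
    obtain ⟨k, c, u, hu⟩ := Submodule.mem_span_set'.mp hsp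
    choose v hvI hv using fun i => (u i).2
    have hcoeff : ∀ e, coeff e f = ∑ i, (coeff e (v i)) • c i := by
      intro e
      rw [← hu, coeff_sum]
      refine Finset.sum_congr rfl fun i _ => ?_
      rw [coeff_smul, ← hv i, liftMap, coeff_map, smul_eq_mul, mul_comm]
      rfl
    have htower : IsScalarTower A (FractionRing A) K := FractionRing.isScalarTower_liftAlgebra A K
    obtain ⟨φ, hφ⟩ : ∃ φ : Module.Dual (FractionRing A) K, φ (coeff d f) ≠ 0 := by
      by_contra hcon
      push Not at hcon
      exact hd.1 ((Module.forall_dual_apply_eq_zero_iff _ _).mp hcon)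
    obtain ⟨s, hs⟩ := IsLocalization.exist_integer_multiples_of_finite
      (nonZeroDivisors A) (fun i => φ (c i))
    choose b hb using hs
    have hs0 : algebraMap A (FractionRing A) s ≠ 0 :=
      IsFractionRing.to_map_ne_zero_of_mem_nonZeroDivisors s.2
    have key : ∀ e, algebraMap A (FractionRing A) (coeff e (∑ i, C (b i) * v i))
        = algebraMap A (FractionRing A) s * φ (coeff e f) := by
      intro e
      rw [hcoeff, coeff_sum, map_sum, map_sum, Finset.mul_sum]
      refine Finset.sum_congr rfl fun i _ => ?_
      rw [coeff_C_mul, map_mul, hb i, ← algebraMap_smul (FractionRing A) (coeff e (v i)) (c i),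
        map_smul, Algebra.smul_def, smul_eq_mul]
      ring
    refine ⟨∑ i, C (b i) * v i, Ideal.sum_mem _ fun i _ => Ideal.mul_mem_left _ _ (hvI i), ?_, ?_⟩
    · intro h0
      have h1 := key d
      rw [h0, map_zero] at h1
      exact mul_ne_zero hs0 hφ h1.symm
    · intro e he
      apply hd.2
      intro h0
      apply he
      have h1 := key e
      rw [h0, map_zero, mul_zero] at h1
      exact (IsFractionRing.injective A (FractionRing A)) (by rw [h1, map_zero])

end

theorem red_eq_zero_iff {K : Type*} [Field K] (A : Subalgebra ℤ K) (P : Ideal A) [P.IsPrime]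
    (x : A) : ((algebraMap (A ⧸ P) (FractionRing (A ⧸ P))).comp (Ideal.Quotient.mk P)) x = 0
      ↔ x ∈ P := by
  rw [RingHom.comp_apply, map_eq_zero_iff _ (IsFractionRing.injective (A ⧸ P) _),
    Ideal.Quotient.eq_zero_iff_mem]

/-- Clearing denominators for polynomials. -/
theorem clear_poly {σ A F : Type*} [CommRing A] [Field F] (ρ : A →+* F)
    (hρ : ∀ c : F, ∃ s x : A, ρ s ≠ 0 ∧ ρ s * c = ρ x) (f : MvPolynomial σ F) :
    ∃ s : A, ρ s ≠ 0 ∧ ∃ h : MvPolynomial σ A, C (ρ s) * f = MvPolynomial.map ρ h := by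
  induction f using MvPolynomial.induction_on with
  | C c =>
    obtain ⟨s, x, hs, hx⟩ := hρ c
    exact ⟨s, hs, C x, by rw [map_C, ← C_mul, hx]⟩
  | add p q hp hq =>
    obtain ⟨s, hs, h, hh⟩ := hp
    obtain ⟨t, ht, k, hk⟩ := hq
    refine ⟨s * t, by rw [map_mul]; exact mul_ne_zero hs ht, C t * h + C s * k, ?_⟩
    simp only [map_mul, map_add, map_C, ← hh, ← hk]
    ring
  | mul_X p i hp =>
    obtain ⟨s, hs, h, hh⟩ := hp
    refine ⟨s, hs, h * X i, ?_⟩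
    rw [map_mul, ← hh, map_X, mul_assoc]

theorem clear_ideal {σ A F : Type*} [CommRing A] [Field F] (ρ : A →+* F)
    (hρ : ∀ c : F, ∃ s x : A, ρ s ≠ 0 ∧ ρ s * c = ρ x) (I' : Ideal (MvPolynomial σ A))
    (f : MvPolynomial σ F) (hf : f ∈ Ideal.map (MvPolynomial.map ρ) I') :
    ∃ s : A, ρ s ≠ 0 ∧ ∃ h ∈ I', C (ρ s) * f = MvPolynomial.map ρ h := by
  rw [Ideal.map] at hf
  induction hf using Submodule.span_induction with
  | mem x hx =>
    obtain ⟨u, hu, rfl⟩ := hx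
    exact ⟨1, by simp, u, hu, by simp⟩
  | zero => exact ⟨1, by simp, 0, zero_mem _, by simp⟩
  | add p q _ _ hp hq =>
    obtain ⟨s, hs, h, hI, hh⟩ := hp
    obtain ⟨t, ht, k, kI, hk⟩ := hq
    refine ⟨s * t, by rw [map_mul]; exact mul_ne_zero hs ht, C t * h + C s * k,
      I'.add_mem (I'.mul_mem_left _ hI) (I'.mul_mem_left _ kI), ?_⟩
    simp only [map_mul, map_add, map_C, ← hh, ← hk]
    ring
  | smul p x _ hx =>
    obtain ⟨s, hs, h, hI, hh⟩ := hx
    obtain ⟨t, ht, k, hk⟩ := clear_poly ρ hρ p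
    refine ⟨s * t, by rw [map_mul]; exact mul_ne_zero hs ht, k * h, I'.mul_mem_left _ hI, ?_⟩
    simp only [map_mul, ← hh, ← hk, smul_eq_mul]
    ring

theorem exists_frac {A : Type*} [CommRing A] (P : Ideal A) [hP : P.IsPrime]
    (c : FractionRing (A ⧸ P)) :
    ∃ s x : A, ((algebraMap (A ⧸ P) (FractionRing (A ⧸ P))).comp (Ideal.Quotient.mk P)) s ≠ 0 ∧
      ((algebraMap (A ⧸ P) (FractionRing (A ⧸ P))).comp (Ideal.Quotient.mk P)) s * c
      = ((algebraMap (A ⧸ P) (FractionRing (A ⧸ P))).comp (Ideal.Quotient.mk P)) x := by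
  obtain ⟨⟨x, y⟩, hxy⟩ := IsLocalization.surj (nonZeroDivisors (A ⧸ P)) c
  obtain ⟨x', rfl⟩ := Ideal.Quotient.mk_surjective x
  obtain ⟨y', hy'⟩ := Ideal.Quotient.mk_surjective y.1
  refine ⟨y', x', ?_, ?_⟩
  · rw [RingHom.comp_apply, hy']
    exact IsFractionRing.to_map_ne_zero_of_mem_nonZeroDivisors y.2
  · rw [RingHom.comp_apply, RingHom.comp_apply, hy', mul_comm]
    exact hxy

theorem leadSet_map {n : ℕ} {K : Type*} [Field K] (m : MonomialOrder (Fin n))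
    (A : Subalgebra ℤ K) (P : Ideal A) [hP : P.IsPrime] (I' : Ideal (MvPolynomial (Fin n) A))
    (a : A) (haP : a ∉ P)
    (hg : ∀ d ∈ leadSet m I', ∃ g ∈ I', IsLead m g d ∧ coeff d g = a) :
    leadSet m (Ideal.map (redMap A P) I') = leadSet m I' := by
  have hred : ∀ (h : MvPolynomial (Fin n) A) e, coeff e (redMap A P h) = 0 ↔ coeff e h ∈ P := by
    intro h e
    rw [redMap, coeff_map, red_eq_zero_iff]
  apply Set.Subset.antisymm
  · rintro d ⟨f, hf, hd⟩
    obtain ⟨s, hs0, h, hI, hh⟩ := clear_ideal _ (exists_frac P) I' f hf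
    have hc : ∀ e, coeff e h ∈ P ↔ coeff e f = 0 := by
      intro e
      rw [← hred, redMap, ← hh, coeff_C_mul, mul_eq_zero, or_iff_right hs0]
    refine lead_mod m I' a hg P haP h hI d (fun h0 => hd.1 ((hc d).mp h0)) fun e he => ?_
    exact hd.2 e fun h0 => he ((hc e).mpr h0)
  · intro d hd
    obtain ⟨g, hgI, hgl, hga⟩ := hg d hd
    refine ⟨redMap A P g, Ideal.mem_map_of_mem _ hgI, ?_, ?_⟩
    · rw [Ne, hred, hga]
      exact haP
    · intro e he
      refine hgl.2 e fun h0 => he ?_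
      rw [hred, h0]
      exact zero_mem _

theorem reduction_span_monomial {n : ℕ} {K : Type*} [Field K]
    (A : Subalgebra ℤ K) (P : Ideal A) [hP : P.IsPrime] (S : Set (Fin n →₀ ℕ)) :
    idealReduction A P (Ideal.span ((fun s => monomial s (1 : K)) '' S)) =
      Ideal.span ((fun s => monomial s (1 : FractionRing (A ⧸ P))) '' S) := by
  apply le_antisymm
  · refine Ideal.map_le_iff_le_comap.mpr fun f hf => ?_
    rw [Ideal.mem_comap, mem_ideal_span_monomial_image] at hf ⊢
    intro e he
    apply hf
    rw [mem_support_iff] at he ⊢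
    intro h0
    apply he
    rw [liftMap, coeff_map] at h0
    have : coeff e f = 0 := Subtype.val_injective h0
    rw [redMap, coeff_map, this, map_zero]
  · refine Ideal.span_le.mpr ?_
    rintro _ ⟨d, hd, rfl⟩
    have : monomial d (1 : FractionRing (A ⧸ P)) = redMap A P (monomial d 1) := by
      simp [redMap]
    show monomial d (1 : FractionRing (A ⧸ P)) ∈ _
    rw [this]
    refine Ideal.mem_map_of_mem _ ?_
    rw [Ideal.mem_comap]
    exact Ideal.subset_span ⟨d, hd, by simp [liftMap]⟩

/-- **Lemma (reduction mod p commutes with initial ideals).** Let `K` be a field of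
characteristic `0`, `I₁,…,I_N` ideals of `K[x₁,…,xₙ]`, and `A ⊆ K` a finitely generated
`ℤ`-algebra containing the coefficients of fixed finite generating sets of the `I_j`.
Then for all sufficiently large primes `p` there is a minimal prime `P` of `pA` such that
`lt(I_j(p)) = lt(I_j)(p)` for all `j`. -/
theorem initialIdeal_reduction_commute {n : ℕ} {K : Type*} [Field K] [CharZero K]
    (m : MonomialOrder (Fin n)) (A : Subalgebra ℤ K) (hA : A.FG)
    (N : ℕ) (I : Fin N → Ideal (MvPolynomial (Fin n) K))
    (G : Fin N → Finset (MvPolynomial (Fin n) K))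
    (hGI : ∀ j, I j = Ideal.span (G j))
    (hGA : ∀ j, ∀ g ∈ G j, ∀ d, MvPolynomial.coeff d g ∈ A) :
    ∃ p₀ : ℕ, ∀ p : ℕ, p₀ < p → p.Prime →
      ∃ P ∈ (Ideal.span {(p : ↥A)}).minimalPrimes,
        ∀ j, m.initialIdeal (idealReduction A P (I j)) =
          idealReduction A P (m.initialIdeal (I j)) := by
  classical
  have : Algebra.FiniteType ℤ A := A.fg_iff_finiteType.mp hA
  choose a ha0 ha using fun j => exists_uniform m (Ideal.comap (liftMap A) (I j))
  obtain ⟨p₀, hp₀⟩ := exists_prime_avoid (∏ j, a j) (Finset.prod_ne_zero_iff.mpr fun j _ => ha0 j)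
  refine ⟨p₀, fun p hp hpp => ?_⟩
  obtain ⟨P, hP, haP⟩ := hp₀ p hp hpp
  refine ⟨P, hP, fun j => ?_⟩
  have hPp : P.IsPrime := hP.1.1
  have haj : a j ∉ P := fun h => haP (Ideal.mem_of_dvd _ (Finset.dvd_prod_of_mem a (Finset.mem_univ j)) h)
  rw [initialIdeal_eq m (I j), reduction_span_monomial, initialIdeal_eq, idealReduction,
    leadSet_map m A P _ (a j) haj (ha j), leadSet_comap m A (I j) (G j) (hGI j) (hGA j)]
end

section
/- Let K be a field of characteristic 0, S = K[x₁,…,xₙ] with a fixed term order ≺, and let f ∈ S have squarefree leading term. If I ∈ C_f, then for all sufficiently large primes p there is a reduction modulo p such that I(p) ∈ C_{f(p)}, where C_{f(p)} is the Knutson family associated to the reduction f(p) in the polynomial ring S_p over a field of characteristic p. -/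
set_option synthInstance.maxHeartbeats 1000000
set_option maxHeartbeats 1000000

open MvPolynomial

namespace KR

universe u v w

open scoped MonomialOrder

section Reduction

variable {A : Type u} [CommRing A] {σ : Type*}

/-- Every element of the target is a fraction of elements of the source. -/
def Good {k : Type*} [Field k] (ψ : A →+* k) : Prop :=
  ∀ y : k, ∃ a b : A, ψ b ≠ 0 ∧ ψ b * y = ψ a

/-- reduction of an ideal -/
noncomputable def red {L k : Type*} [Field L] [Field k] (ι : A →+* L) (ψ : A →+* k)
    (I : Ideal (MvPolynomial σ L)) : Ideal (MvPolynomial σ k) :=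
  Ideal.map (MvPolynomial.map ψ) (Ideal.comap (MvPolynomial.map ι) I)

/-- The set of leading exponents of an ideal. -/
def degs {L : Type*} [CommRing L] (m : MonomialOrder σ) (I : Ideal (MvPolynomial σ L)) :
    Set (σ →₀ ℕ) := {a | ∃ g ∈ I, g ≠ 0 ∧ m.degree g = a}

lemma Good.clear {k : Type*} [Field k] {ψ : A →+* k} (hψ : Good ψ) (u : MvPolynomial σ k) :
    ∃ t, ψ t ≠ 0 ∧ ∃ h : MvPolynomial σ A, C (ψ t) * u = MvPolynomial.map ψ h := by
  induction u using MvPolynomial.induction_on with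
  | C y =>
    obtain ⟨a, b, hb, h⟩ := hψ y
    exact ⟨b, hb, C a, by rw [← C_mul, h, map_C]⟩
  | add p q hp hq =>
    obtain ⟨t, ht, h, e⟩ := hp
    obtain ⟨t', ht', h', e'⟩ := hq
    refine ⟨t * t', by simp [ht, ht'], C t' * h + C t * h', ?_⟩
    simp only [map_add, map_mul, map_C, ← e, ← e']
    ring
  | mul_X p i hp =>
    obtain ⟨t, ht, h, e⟩ := hp
    refine ⟨t, ht, h * X i, ?_⟩
    rw [← mul_assoc, e]; simp

lemma mem_red {L k : Type*} [Field L] [Field k] {ι : A →+* L} {ψ : A →+* k} (hψ : Good ψ)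
    {I : Ideal (MvPolynomial σ L)} {u : MvPolynomial σ k} (hu : u ∈ red ι ψ I) :
    ∃ t, ψ t ≠ 0 ∧ ∃ h : MvPolynomial σ A, MvPolynomial.map ι h ∈ I ∧
      C (ψ t) * u = MvPolynomial.map ψ h := by
  refine Submodule.span_induction (p := fun u _ => ∃ t, ψ t ≠ 0 ∧ ∃ h : MvPolynomial σ A,
    MvPolynomial.map ι h ∈ I ∧ C (ψ t) * u = MvPolynomial.map ψ h) ?_ ?_ ?_ ?_ hu
  · rintro _ ⟨h, hh, rfl⟩
    exact ⟨1, by simp, h, hh, by simp⟩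
  · exact ⟨1, by simp, 0, by simp, by simp⟩
  · rintro x y - - ⟨t, ht, h, hh, e⟩ ⟨t', ht', h', hh', e'⟩
    refine ⟨t * t', by simp [ht, ht'], C t' * h + C t * h', ?_, ?_⟩
    · simp only [map_add, map_mul]
      exact I.add_mem (I.mul_mem_left _ hh) (I.mul_mem_left _ hh')
    · simp only [map_add, map_mul, map_C, ← e, ← e']
      ring
  · rintro v x - ⟨t, ht, h, hh, e⟩
    obtain ⟨t', ht', h', e'⟩ := hψ.clear v
    refine ⟨t * t', by simp [ht, ht'], h' * h, ?_, ?_⟩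
    · simp only [map_mul]
      exact I.mul_mem_left _ hh
    · simp only [map_mul, ← e, ← e', smul_eq_mul]
      ring

lemma mem_of_C_mul {k : Type*} [Field k] {c : k} (hc : c ≠ 0) {I : Ideal (MvPolynomial σ k)}
    {u : MvPolynomial σ k} (h : C c * u ∈ I) : u ∈ I := by
  have := I.mul_mem_left (C c⁻¹) h
  rwa [← mul_assoc, ← C_mul, inv_mul_cancel₀ hc, C_1, one_mul] at this

lemma map_mem_red {L k : Type*} [Field L] [Field k] {ι : A →+* L} {ψ : A →+* k}
    {I : Ideal (MvPolynomial σ L)} {h : MvPolynomial σ A} (hh : MvPolynomial.map ι h ∈ I) :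
    MvPolynomial.map ψ h ∈ red ι ψ I := Ideal.mem_map_of_mem _ hh

lemma degree_map_of_ne {R k : Type*} [CommRing R] [CommRing k] (m : MonomialOrder σ) (ψ : R →+* k)
    (h : MvPolynomial σ R) (hh : ψ (m.leadingCoeff h) ≠ 0) :
    m.degree (MvPolynomial.map ψ h) = m.degree h := by
  apply m.toSyn.injective
  apply le_antisymm
  · rw [m.degree_le_iff]
    intro c hc
    exact m.le_degree (support_map_subset _ _ hc)
  · apply m.le_degree
    rw [mem_support_iff, coeff_map]
    exact hh

lemma degree_map_of_inj {R k : Type*} [CommRing R] [CommRing k] (m : MonomialOrder σ)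
    {ψ : R →+* k} (hψ : Function.Injective ψ) (h : MvPolynomial σ R) :
    m.degree (MvPolynomial.map ψ h) = m.degree h := by
  by_cases h0 : h = 0
  · simp [h0]
  · apply degree_map_of_ne
    rw [map_ne_zero_iff _ hψ]
    simpa using h0

lemma degree_lt_of {R : Type*} [CommRing R] (m : MonomialOrder σ) {h : MvPolynomial σ R}
    {a : σ →₀ ℕ} (hle : m.degree h ≼[m] a) (ha : h.coeff a = 0) (h0 : h ≠ 0) :
    m.degree h ≺[m] a := by
  refine lt_of_le_of_ne hle fun e => ?_
  have e := m.toSyn.injective e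
  apply (m.coeff_degree_ne_zero_iff (f := h)).2 h0
  rw [e, ha]

/-- One reduction step. -/
lemma step {R : Type*} [CommRing R] [IsDomain R] (m : MonomialOrder σ) (h g : MvPolynomial σ R)
    (hg : m.degree g ≤ m.degree h) :
    let h1 := C (m.leadingCoeff g) * h -
      monomial (m.degree h - m.degree g) (m.leadingCoeff h) * g
    h1 ≠ 0 → m.degree h1 ≺[m] m.degree h := by
  intro h1 h0
  have hadd : m.degree h - m.degree g + m.degree g = m.degree h := tsub_add_cancel_of_le hg
  apply degree_lt_of m _ _ h0
  · refine m.degree_sub_le.trans (sup_le ?_ ?_)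
    · refine m.degree_mul_le.trans ?_
      simp [m.degree_C]
    · refine m.degree_mul_le.trans ?_
      conv_rhs => rw [← hadd]
      rw [map_add, map_add]
      gcongr
      exact m.degree_monomial_le _
  · have : coeff (m.degree h) (monomial (m.degree h - m.degree g) (m.leadingCoeff h) * g)
      = m.leadingCoeff h * m.leadingCoeff g := by
      have := coeff_monomial_mul (m.degree g) (m.degree h - m.degree g) (m.leadingCoeff h) g
      rw [hadd] at this
      exact this
    simp only [h1, coeff_sub, coeff_C_mul, this]
    change m.leadingCoeff g * m.leadingCoeff h - _ = 0
    ring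

lemma degs_upper {L : Type*} [Field L] (m : MonomialOrder σ) (I : Ideal (MvPolynomial σ L))
    {a b : σ →₀ ℕ} (ha : a ∈ degs m I) (hab : a ≤ b) : b ∈ degs m I := by
  obtain ⟨g, hg, h0, rfl⟩ := ha
  refine ⟨monomial (b - m.degree g) 1 * g, I.mul_mem_left _ hg, mul_ne_zero (by simp) h0, ?_⟩
  rw [m.degree_mul (by simp) h0]
  classical
  rw [m.degree_monomial, if_neg one_ne_zero]
  exact tsub_add_cancel_of_le hab

lemma exists_groebner [Finite σ] {L : Type*} [Field L] (m : MonomialOrder σ) {ι : A →+* L}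
    (hι : Good ι) (hinj : Function.Injective ι) (I : Ideal (MvPolynomial σ L)) :
    ∃ G : Finset (MvPolynomial σ A), (∀ g ∈ G, g ≠ 0 ∧ MvPolynomial.map ι g ∈ I) ∧
      ∀ a ∈ degs m I, ∃ g ∈ G, m.degree g ≤ a := by
  classical
  have hfg : (Ideal.span ((fun s => monomial s (1 : L)) '' degs m I)).FG :=
    IsNoetherian.noetherian _
  obtain ⟨t, hts, ht⟩ := (Submodule.fg_span_iff_fg_span_finset_subset _).1 hfg
  have hch : ∀ a ∈ degs m I, ∃ g : MvPolynomial σ A, g ≠ 0 ∧ MvPolynomial.map ι g ∈ I ∧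
      m.degree g = a := by
    rintro a ⟨g, hg, h0, rfl⟩
    obtain ⟨s, hs, h, e⟩ := hι.clear g
    have hne : MvPolynomial.map ι h ≠ 0 := by
      rw [← e]; exact mul_ne_zero (by simpa using hs) h0
    refine ⟨h, fun h' => hne (by simp [h']), e ▸ I.mul_mem_left _ hg, ?_⟩
    rw [← degree_map_of_inj m hinj, ← e, m.degree_mul (by simpa using hs) h0]
    simp [m.degree_C]
  obtain ⟨T, hTs, hT⟩ : ∃ T : Finset (σ →₀ ℕ), (T : Set (σ →₀ ℕ)) ⊆ degs m I ∧
      (fun s => monomial s (1 : L)) '' (T : Set (σ →₀ ℕ)) = t := by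
    obtain ⟨T, h1, h2⟩ := Finset.subset_set_image_iff.1 hts
    exact ⟨T, h1, by rw [← h2]; simp⟩
  choose! φ hφ using hch
  refine ⟨T.image φ, ?_, ?_⟩
  · intro g hg
    obtain ⟨a, ha, rfl⟩ := Finset.mem_image.1 hg
    exact ⟨(hφ a (hTs ha)).1, (hφ a (hTs ha)).2.1⟩
  · intro a ha
    have hm : monomial a (1 : L) ∈ Ideal.span ((fun s => monomial s (1 : L)) '' (T : Set (σ →₀ ℕ))) := by
      have : monomial a (1 : L) ∈ Ideal.span ((fun s => monomial s (1 : L)) '' degs m I) :=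
        Ideal.subset_span ⟨a, ha, rfl⟩
      rw [hT]
      have ht' : Ideal.span ((fun s => monomial s (1 : L)) '' degs m I) = Ideal.span (t : Set _) := ht
      rwa [ht'] at this
    rw [mem_ideal_span_monomial_image] at hm
    obtain ⟨b, hb, hba⟩ := hm a (by simp)
    exact ⟨φ b, Finset.mem_image_of_mem _ hb, by rw [(hφ b (hTs hb)).2.2]; exact hba⟩

/-- A statement holds for generic reductions. -/
def Gen (A : Type u) [CommRing A] (Q : ∀ (k : Type u) [Field k], (A →+* k) → Prop) : Prop :=
  ∃ s : A, s ≠ 0 ∧ ∀ (k : Type u) [Field k] (ψ : A →+* k), Good ψ → ψ s ≠ 0 → Q k ψ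

lemma Gen.and [IsDomain A] {Q Q' : ∀ (k : Type u) [Field k], (A →+* k) → Prop} (h : Gen A Q)
    (h' : Gen A Q') : Gen A (fun k _ ψ => Q k ψ ∧ Q' k ψ) := by
  obtain ⟨s, hs, h⟩ := h
  obtain ⟨s', hs', h'⟩ := h'
  refine ⟨s * s', mul_ne_zero hs hs', fun k _ ψ hψ hne => ?_⟩
  rw [map_mul] at hne
  exact ⟨h k ψ hψ (left_ne_zero_of_mul hne), h' k ψ hψ (right_ne_zero_of_mul hne)⟩

lemma Gen.mono {Q Q' : ∀ (k : Type u) [Field k], (A →+* k) → Prop} (h : Gen A Q)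
    (hh : ∀ (k : Type u) [Field k] (ψ : A →+* k), Good ψ → Q k ψ → Q' k ψ) : Gen A Q' := by
  obtain ⟨s, hs, h⟩ := h
  exact ⟨s, hs, fun k _ ψ hψ hne => hh k ψ hψ (h k ψ hψ hne)⟩

lemma Gen.forall_finset [IsDomain A] {α : Type*} (T : Finset α)
    {Q : α → ∀ (k : Type u) [Field k], (A →+* k) → Prop} (h : ∀ a ∈ T, Gen A (Q a)) :
    Gen A (fun k _ ψ => ∀ a ∈ T, Q a k ψ) := by
  classical
  induction T using Finset.induction_on with
  | empty => exact ⟨1, one_ne_zero, by simp⟩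
  | insert a T ha ih =>
    refine ((h a (by simp)).and (ih fun b hb => h b (by simp [hb]))).mono ?_
    rintro k _ ψ - ⟨h1, h2⟩ b hb
    rcases Finset.mem_insert.1 hb with rfl | hb
    · exact h1
    · exact h2 b hb

lemma Gen.ne {s : A} (hs : s ≠ 0) : Gen A (fun k _ ψ => ψ s ≠ 0) :=
  ⟨s, hs, fun _ _ _ _ h => h⟩

variable [IsDomain A] [Finite σ] {L : Type v} [Field L] {ι : A →+* L}

lemma gen_degs (m : MonomialOrder σ) (hι : Good ι) (hinj : Function.Injective ι)
    (I : Ideal (MvPolynomial σ L)) :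
    Gen A (fun k _ ψ => degs m (red ι ψ I) = degs m I) := by
  obtain ⟨G, hG, hGr⟩ := exists_groebner m hι hinj I
  refine (Gen.forall_finset G (Q := fun g k _ ψ => ψ (m.leadingCoeff g) ≠ 0)
    (fun g hg => Gen.ne (by simpa using (hG g hg).1))).mono ?_
  intro k _ ψ hψ hne
  apply Set.Subset.antisymm
  · rintro a ⟨u, hu, h0, rfl⟩
    obtain ⟨t, ht, h, hh, e⟩ := mem_red hψ hu
    have key : ∀ d : m.syn, ∀ h : MvPolynomial σ A, m.toSyn (m.degree h) = d →
        MvPolynomial.map ι h ∈ I → MvPolynomial.map ψ h ≠ 0 →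
        m.degree (MvPolynomial.map ψ h) ∈ degs m I := by
      intro d
      induction d using WellFoundedLT.induction with
      | ind d ih =>
      intro h hd hh h0
      have hh0 : h ≠ 0 := fun e => h0 (by simp [e])
      have hmem : m.degree h ∈ degs m I :=
        ⟨_, hh, by rwa [Ne, map_eq_zero_iff _ (map_injective _ hinj)], degree_map_of_inj m hinj h⟩
      by_cases hlc : ψ (m.leadingCoeff h) = 0
      · obtain ⟨g, hg, hgh⟩ := hGr _ hmem
        have hst := step m h g hgh
        set h1 := C (m.leadingCoeff g) * h -
          monomial (m.degree h - m.degree g) (m.leadingCoeff h) * g with hh1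
        have e1 : MvPolynomial.map ψ h1 = C (ψ (m.leadingCoeff g)) * MvPolynomial.map ψ h := by
          rw [hh1]; simp [map_monomial, hlc]
        have hn1 : MvPolynomial.map ψ h1 ≠ 0 := by
          rw [e1]; exact mul_ne_zero (by simpa using hne g hg) h0
        have hlt := hst (fun e => hn1 (by simp [e]))
        have := ih _ (hd ▸ hlt) h1 rfl (by
          rw [hh1]; simp only [map_sub, map_mul]
          exact I.sub_mem (I.mul_mem_left _ hh) (I.mul_mem_left _ (hG g hg).2)) hn1
        rwa [e1, m.degree_mul (by simpa using hne g hg) h0, m.degree_C, zero_add] at this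
      · rwa [degree_map_of_ne m ψ h hlc]
    have hn : MvPolynomial.map ψ h ≠ 0 := by
      rw [← e]; exact mul_ne_zero (by simpa using ht) h0
    have := key _ h rfl hh hn
    rwa [← e, m.degree_mul (by simpa using ht) h0, m.degree_C, zero_add] at this
  · intro a ha
    obtain ⟨g, hg, hga⟩ := hGr a ha
    refine degs_upper m _ ⟨MvPolynomial.map ψ g, map_mem_red (hG g hg).2, ?_,
      degree_map_of_ne m ψ g (hne g hg)⟩ hga
    intro e
    apply hne g hg
    have := congrArg (coeff (m.degree g)) e
    simpa [coeff_map, MonomialOrder.leadingCoeff] using this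

/-- Generic flatness. -/
lemma gen_flat (hι : Good ι) (hinj : Function.Injective ι)
    (I : Ideal (MvPolynomial σ L)) (m : MonomialOrder σ) :
    Gen A (fun k _ ψ => ∀ h : MvPolynomial σ A, MvPolynomial.map ι h ∈ I →
      MvPolynomial.map ψ h = 0 → ∃ t, ψ t ≠ 0 ∧
        C t * h ∈ (Ideal.map C (RingHom.ker ψ)) * Ideal.comap (MvPolynomial.map ι) I) := by
  obtain ⟨G, hG, hGr⟩ := exists_groebner m hι hinj I
  refine (Gen.forall_finset G (Q := fun g k _ ψ => ψ (m.leadingCoeff g) ≠ 0)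
    (fun g hg => Gen.ne (by simpa using (hG g hg).1))).mono ?_
  intro k _ ψ hψ hne
  have key : ∀ d : m.syn, ∀ h : MvPolynomial σ A, m.toSyn (m.degree h) = d →
      MvPolynomial.map ι h ∈ I → MvPolynomial.map ψ h = 0 → ∃ t, ψ t ≠ 0 ∧
        C t * h ∈ (Ideal.map C (RingHom.ker ψ)) * Ideal.comap (MvPolynomial.map ι) I := by
    intro d
    induction d using WellFoundedLT.induction with
    | ind d ih =>
    intro h hd hh h0
    by_cases hh0 : h = 0
    · exact ⟨1, by simp, by simp [hh0]⟩
    have hmem : m.degree h ∈ degs m I :=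
      ⟨_, hh, by rwa [Ne, map_eq_zero_iff _ (map_injective _ hinj)], degree_map_of_inj m hinj h⟩
    have hlc : ψ (m.leadingCoeff h) = 0 := by
      have := congrArg (coeff (m.degree h)) h0
      simpa [coeff_map, MonomialOrder.leadingCoeff] using this
    obtain ⟨g, hg, hgh⟩ := hGr _ hmem
    have hst := step m h g hgh
    set h1 := C (m.leadingCoeff g) * h -
      monomial (m.degree h - m.degree g) (m.leadingCoeff h) * g with hh1
    have hpg : monomial (m.degree h - m.degree g) (m.leadingCoeff h) * g ∈
        (Ideal.map C (RingHom.ker ψ)) * Ideal.comap (MvPolynomial.map ι) I := by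
      refine Ideal.mul_mem_mul ?_ (show g ∈ Ideal.comap (MvPolynomial.map ι) I from (hG g hg).2)
      rw [show monomial (m.degree h - m.degree g) (m.leadingCoeff h) =
        monomial (m.degree h - m.degree g) 1 * C (m.leadingCoeff h) by
          rw [mul_comm, C_mul_monomial, mul_one]]
      exact Ideal.mul_mem_left _ _ (Ideal.mem_map_of_mem _ hlc)
    by_cases h10 : h1 = 0
    · refine ⟨_, hne g hg, ?_⟩
      rw [hh1, sub_eq_zero] at h10
      rwa [h10]
    · obtain ⟨t, ht, htm⟩ := ih _ (hd ▸ hst h10) h1 rfl (by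
          rw [hh1]; simp only [map_sub, map_mul]
          exact I.sub_mem (I.mul_mem_left _ hh) (I.mul_mem_left _ (hG g hg).2)) (by
          rw [hh1]; simp [map_monomial, hlc, h0])
      refine ⟨t * m.leadingCoeff g, by simpa [ht] using hne g hg, ?_⟩
      have : C (t * m.leadingCoeff g) * h = C t * h1 +
        C t * (monomial (m.degree h - m.degree g) (m.leadingCoeff h) * g) := by
        rw [hh1, C_mul]; ring
      rw [this]
      exact Ideal.add_mem _ htm (Ideal.mul_mem_left _ _ hpg)
  intro h hh h0
  exact key _ h rfl hh h0

end Reduction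


section Commute

variable {A : Type u} [CommRing A] {σ : Type*}

/-- Elements landing in `Q` after multiplication by something not killed by `ψ`. -/
def sat {k : Type*} [Field k] (ψ : A →+* k) (Q : Ideal (MvPolynomial σ A)) :
    Ideal (MvPolynomial σ A) where
  carrier := {h | ∃ s, ψ s ≠ 0 ∧ C s * h ∈ Q}
  add_mem' := by
    rintro x y ⟨s, hs, hx⟩ ⟨t, ht, hy⟩
    refine ⟨s * t, by simp [hs, ht], ?_⟩
    have : C (s * t) * (x + y) = C t * (C s * x) + C s * (C t * y) := by rw [C_mul]; ring
    rw [this]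
    exact Q.add_mem (Q.mul_mem_left _ hx) (Q.mul_mem_left _ hy)
  zero_mem' := ⟨1, by simp, by simp⟩
  smul_mem' := by
    rintro c x ⟨s, hs, hx⟩
    refine ⟨s, hs, ?_⟩
    rw [smul_eq_mul, mul_left_comm]
    exact Q.mul_mem_left _ hx

lemma mem_sat {k : Type*} [Field k] {ψ : A →+* k} {Q : Ideal (MvPolynomial σ A)}
    {h : MvPolynomial σ A} : h ∈ sat ψ Q ↔ ∃ s, ψ s ≠ 0 ∧ C s * h ∈ Q := Iff.rfl

lemma mem_map_clear {k : Type*} [Field k] {ψ : A →+* k} (hψ : Good ψ)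
    {Q : Ideal (MvPolynomial σ A)} {u : MvPolynomial σ k}
    (hu : u ∈ Ideal.map (MvPolynomial.map ψ) Q) :
    ∃ t, ψ t ≠ 0 ∧ ∃ h ∈ Q, C (ψ t) * u = MvPolynomial.map ψ h := by
  refine Submodule.span_induction (p := fun u _ => ∃ t, ψ t ≠ 0 ∧ ∃ h ∈ Q,
    C (ψ t) * u = MvPolynomial.map ψ h) ?_ ?_ ?_ ?_ hu
  · rintro _ ⟨h, hh, rfl⟩
    exact ⟨1, by simp, h, hh, by simp⟩
  · exact ⟨1, by simp, 0, by simp, by simp⟩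
  · rintro x y - - ⟨t, ht, h, hh, e⟩ ⟨t', ht', h', hh', e'⟩
    refine ⟨t * t', by simp [ht, ht'], C t' * h + C t * h', ?_, ?_⟩
    · exact Q.add_mem (Q.mul_mem_left _ hh) (Q.mul_mem_left _ hh')
    · simp only [map_add, map_mul, map_C, ← e, ← e']
      ring
  · rintro v x - ⟨t, ht, h, hh, e⟩
    obtain ⟨t', ht', h', e'⟩ := hψ.clear v
    refine ⟨t * t', by simp [ht, ht'], h' * h, ?_, ?_⟩
    · exact Q.mul_mem_left _ hh
    · simp only [map_mul, ← e, ← e', smul_eq_mul]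
      ring

lemma red_le_of_sat {L k : Type*} [Field L] [Field k] {ι : A →+* L} {ψ : A →+* k}
    {N : Ideal (MvPolynomial σ L)} {Q : Ideal (MvPolynomial σ A)}
    (h : Ideal.comap (MvPolynomial.map ι) N ≤ sat ψ Q) :
    red ι ψ N ≤ Ideal.map (MvPolynomial.map ψ) Q := by
  rw [red, Ideal.map_le_iff_le_comap]
  intro x hx
  obtain ⟨s, hs, hq⟩ := h hx
  rw [Ideal.mem_comap]
  apply mem_of_C_mul hs
  have := Ideal.mem_map_of_mem (MvPolynomial.map ψ) hq
  simpa using this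

lemma le_map_comap {L : Type*} [Field L] {ι : A →+* L} (hι : Good ι)
    (I : Ideal (MvPolynomial σ L)) :
    I ≤ Ideal.map (MvPolynomial.map ι) (Ideal.comap (MvPolynomial.map ι) I) := by
  intro x hx
  obtain ⟨t, ht, h, e⟩ := hι.clear x
  apply mem_of_C_mul ht
  rw [e]
  apply Ideal.mem_map_of_mem
  rw [Ideal.mem_comap, ← e]
  exact I.mul_mem_left _ hx

lemma map_eq_zero_of_mem_mul {k : Type*} [Field k] {ψ : A →+* k} {Q : Ideal (MvPolynomial σ A)}
    {h : MvPolynomial σ A} (hh : h ∈ (Ideal.map C (RingHom.ker ψ)) * Q) :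
    MvPolynomial.map ψ h = 0 := by
  have h1 : h ∈ Ideal.map C (RingHom.ker ψ) := (Ideal.mul_le_inf hh).1
  have h2 : Ideal.map C (RingHom.ker ψ) ≤ RingHom.ker (MvPolynomial.map (σ := σ) ψ) := by
    rw [Ideal.map_le_iff_le_comap]
    intro a ha
    rw [Ideal.mem_comap, RingHom.mem_ker, map_C, RingHom.mem_ker.1 ha, C_0]
  exact h2 h1

lemma red_top {L k : Type*} [Field L] [Field k] {ι : A →+* L} {ψ : A →+* k} :
    red ι ψ (⊤ : Ideal (MvPolynomial σ L)) = ⊤ := by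
  rw [red, Ideal.comap_top, Ideal.map_top]

variable [IsDomain A] [IsNoetherianRing A] [Finite σ] {L : Type v} [Field L] {ι : A →+* L}

lemma gen_sat (hι : Good ι) (hinj : Function.Injective ι)
    (N : Ideal (MvPolynomial σ L)) (Q : Ideal (MvPolynomial σ A))
    (hN : N ≤ Ideal.map (MvPolynomial.map ι) Q) :
    Gen A (fun k _ ψ => Ideal.comap (MvPolynomial.map ι) N ≤ sat ψ Q) := by
  obtain ⟨T, hT⟩ : (Ideal.comap (MvPolynomial.map ι) N).FG := IsNoetherian.noetherian _
  refine (Gen.forall_finset T (Q := fun h k _ ψ => h ∈ sat ψ Q) ?_).mono ?_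
  · intro h hh
    have hm : MvPolynomial.map ι h ∈ N := by
      have : h ∈ Ideal.comap (MvPolynomial.map ι) N := hT ▸ Ideal.subset_span hh
      exact this
    obtain ⟨t, ht, q, hq, e⟩ := mem_map_clear hι (hN hm)
    refine (Gen.ne (s := t) (by rintro rfl; simp at ht)).mono ?_
    intro k _ ψ _ hne
    refine ⟨t, hne, ?_⟩
    have : C t * h = q := by
      apply map_injective ι hinj
      rw [← e]; simp
    rwa [this]
  · intro k _ ψ _ h
    rw [← hT]
    exact Ideal.span_le.2 h

lemma gen_base (hι : Good ι) (hinj : Function.Injective ι) (f : MvPolynomial σ A) :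
    Gen A (fun k _ ψ => red ι ψ (Ideal.span {MvPolynomial.map ι f}) =
      Ideal.span {MvPolynomial.map ψ f}) := by
  refine (gen_sat hι hinj (Ideal.span {MvPolynomial.map ι f}) (Ideal.span {f}) ?_).mono ?_
  · simp [Ideal.map_span]
  · intro k _ ψ _ h
    apply le_antisymm
    · have := red_le_of_sat h
      simpa [Ideal.map_span] using this
    · rw [Ideal.span_singleton_le_iff_mem]
      exact map_mem_red (Ideal.mem_span_singleton_self _)

lemma gen_add (hι : Good ι) (hinj : Function.Injective ι) (I J : Ideal (MvPolynomial σ L)) :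
    Gen A (fun k _ ψ => red ι ψ (I + J) = red ι ψ I + red ι ψ J) := by
  refine (gen_sat hι hinj (I ⊔ J) (Ideal.comap (MvPolynomial.map ι) I ⊔
    Ideal.comap (MvPolynomial.map ι) J) ?_).mono ?_
  · rw [Ideal.map_sup]
    exact sup_le_sup (le_map_comap hι I) (le_map_comap hι J)
  · intro k _ ψ _ h
    apply le_antisymm
    · have := red_le_of_sat h
      rwa [Ideal.map_sup] at this
    · exact sup_le (Ideal.map_mono (Ideal.comap_mono le_sup_left))
        (Ideal.map_mono (Ideal.comap_mono le_sup_right))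

/-- flatness combined with a presentation of the ideal -/
lemma gen_flat_sat (m : MonomialOrder σ) (hι : Good ι) (hinj : Function.Injective ι)
    (N : Ideal (MvPolynomial σ L)) (Q : Ideal (MvPolynomial σ A))
    (hN : N ≤ Ideal.map (MvPolynomial.map ι) Q) :
    Gen A (fun k _ ψ => ∀ h : MvPolynomial σ A, MvPolynomial.map ι h ∈ N →
      MvPolynomial.map ψ h = 0 → ∃ t, ψ t ≠ 0 ∧
        C t * h ∈ (Ideal.map C (RingHom.ker ψ)) * Q) := by
  refine ((gen_sat hι hinj N Q hN).and (gen_flat hι hinj N m)).mono ?_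
  rintro k _ ψ - ⟨hs, hf⟩ h hh h0
  obtain ⟨t, ht, htm⟩ := hf h hh h0
  have : (Ideal.map C (RingHom.ker ψ)) * Ideal.comap (MvPolynomial.map ι) N ≤
      sat ψ ((Ideal.map C (RingHom.ker ψ)) * Q) := by
    rw [Ideal.mul_le]
    intro r hr x hx
    obtain ⟨s, hs, hq⟩ := hs hx
    refine ⟨s, hs, ?_⟩
    rw [mul_left_comm]
    exact Ideal.mul_mem_mul hr hq
  obtain ⟨s, hs, hm⟩ := this htm
  refine ⟨s * t, by simp [hs, ht], ?_⟩
  rwa [C_mul, mul_assoc]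

lemma gen_inter (m : MonomialOrder σ) (hι : Good ι) (hinj : Function.Injective ι)
    (I J : Ideal (MvPolynomial σ L)) :
    Gen A (fun k _ ψ => red ι ψ (I ⊓ J) = red ι ψ I ⊓ red ι ψ J) := by
  refine (gen_flat_sat m hι hinj (I ⊔ J) (Ideal.comap (MvPolynomial.map ι) I ⊔
    Ideal.comap (MvPolynomial.map ι) J) ?_).mono ?_
  · rw [Ideal.map_sup]
    exact sup_le_sup (le_map_comap hι I) (le_map_comap hι J)
  · intro k _ ψ hψ hfl
    apply le_antisymm
    · exact le_inf (Ideal.map_mono (Ideal.comap_mono inf_le_left))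
        (Ideal.map_mono (Ideal.comap_mono inf_le_right))
    · rintro u ⟨hu1, hu2⟩
      obtain ⟨t, ht, i, hi, ei⟩ := mem_red hψ hu1
      obtain ⟨t', ht', j, hj, ej⟩ := mem_red hψ hu2
      obtain ⟨s, hs, hm⟩ := hfl (C t' * i - C t * j) (by
        simp only [map_sub, map_mul]
        exact (I ⊔ J).sub_mem ((I ⊔ J).mul_mem_left _ (Ideal.mem_sup_left hi))
          ((I ⊔ J).mul_mem_left _ (Ideal.mem_sup_right hj))) (by
        simp only [map_sub, map_mul, map_C, ← ei, ← ej]; ring)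
      rw [Ideal.mul_sup] at hm
      obtain ⟨i0, hi0, j0, hj0, e⟩ := Submodule.mem_sup.1 hm
      have hw : C (s * t') * i - i0 = C (s * t) * j + j0 := by
        rw [C_mul, C_mul]; linear_combination -e
      have hred : MvPolynomial.map ψ (C (s * t') * i - i0) = C (ψ (s * t' * t)) * u := by
        rw [map_sub, map_eq_zero_of_mem_mul hi0]
        simp only [map_mul, map_C, ← ei]; ring
      apply mem_of_C_mul (c := ψ (s * t' * t)) (by simp [hs, ht, ht'])
      rw [← hred]
      apply map_mem_red
      refine ⟨?_, ?_⟩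
      · have h0 : MvPolynomial.map ι i0 ∈ I := (Ideal.mul_le_inf hi0).2
        simp only [map_sub, map_mul]
        exact I.sub_mem (I.mul_mem_left _ hi) h0
      · have h0 : MvPolynomial.map ι j0 ∈ J := (Ideal.mul_le_inf hj0).2
        rw [hw]
        simp only [map_add, map_mul]
        exact J.add_mem (J.mul_mem_left _ hj) h0

lemma mem_colon_iff {R : Type*} [CommRing R] {I : Ideal R} {S : Set R} {x : R} :
    x ∈ I.colon S ↔ ∀ y ∈ S, x * y ∈ I := by
  rw [Submodule.mem_colon]; rfl

lemma colon_span {R : Type*} [CommRing R] {I : Ideal R} {S : Set R} :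
    I.colon (Ideal.span S : Set R) = I.colon S := by
  ext x
  rw [mem_colon_iff, mem_colon_iff]
  constructor
  · intro h y hy; exact h y (Ideal.subset_span hy)
  · intro h y hy
    induction hy using Submodule.span_induction with
    | mem y hy => exact h y hy
    | zero => simp
    | add y z _ _ hy hz => rw [mul_add]; exact I.add_mem hy hz
    | smul a y _ hy => rw [smul_eq_mul, mul_left_comm]; exact I.mul_mem_left _ hy

lemma gen_colon_single (m : MonomialOrder σ) (hι : Good ι) (hinj : Function.Injective ι)
    (I : Ideal (MvPolynomial σ L)) (g : MvPolynomial σ A) :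
    Gen A (fun k _ ψ => red ι ψ (I.colon {MvPolynomial.map ι g}) =
      (red ι ψ I).colon {MvPolynomial.map ψ g}) := by
  refine (gen_flat_sat m hι hinj (I ⊔ Ideal.span {MvPolynomial.map ι g})
    (Ideal.comap (MvPolynomial.map ι) I ⊔ Ideal.span {g}) ?_).mono ?_
  · rw [Ideal.map_sup]
    exact sup_le_sup (le_map_comap hι I) (by simp [Ideal.map_span])
  · intro k _ ψ hψ hfl
    apply le_antisymm
    · rw [red, Ideal.map_le_iff_le_comap]
      intro h hh
      rw [Ideal.mem_comap, mem_colon_iff] at hh ⊢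
      rintro _ rfl
      have := hh _ rfl
      rw [← map_mul] at this ⊢
      exact map_mem_red this
    · intro u hu
      rw [mem_colon_iff] at hu
      obtain ⟨t, ht, h0, e0⟩ := hψ.clear u
      obtain ⟨t', ht', i, hi, ei⟩ := mem_red hψ (hu _ rfl)
      obtain ⟨s, hs, hm⟩ := hfl (C t' * h0 * g - C t * i) (by
        simp only [map_sub, map_mul]
        refine Ideal.sub_mem _ (Ideal.mul_mem_left _ _ (Ideal.mem_sup_right
          (Ideal.mem_span_singleton_self _))) (Ideal.mul_mem_left _ _ (Ideal.mem_sup_left hi))) (by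
        simp only [map_sub, map_mul, map_C, ← ei, ← e0]; ring)
      rw [Ideal.mul_sup] at hm
      obtain ⟨i0, hi0, j0, hj0, e⟩ := Submodule.mem_sup.1 hm
      obtain ⟨v, hv, rfl⟩ := Ideal.mem_mul_span_singleton.1 hj0
      have hw : (C (s * t') * h0 - v) * g = C (s * t) * i + i0 := by
        rw [C_mul, C_mul]; linear_combination -e
      have hv0 : MvPolynomial.map ψ v = 0 :=
        map_eq_zero_of_mem_mul (Q := ⊤) (by rwa [Ideal.mul_top])
      have hred : MvPolynomial.map ψ (C (s * t') * h0 - v) = C (ψ (s * t' * t)) * u := by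
        rw [map_sub, hv0]
        simp only [map_mul, map_C]
        linear_combination (-C (ψ s) * C (ψ t')) * e0
      apply mem_of_C_mul (c := ψ (s * t' * t)) (by simp [hs, ht, ht'])
      rw [← hred]
      apply map_mem_red
      rw [mem_colon_iff]
      rintro _ rfl
      rw [← map_mul, hw]
      have h0 : MvPolynomial.map ι i0 ∈ I := (Ideal.mul_le_inf hi0).2
      simp only [map_add, map_mul]
      exact I.add_mem (I.mul_mem_left _ hi) h0

lemma gen_colon_finset (m : MonomialOrder σ) (hι : Good ι) (hinj : Function.Injective ι)
    (I : Ideal (MvPolynomial σ L)) (T : Finset (MvPolynomial σ A)) :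
    Gen A (fun k _ ψ => red ι ψ (I.colon (MvPolynomial.map ι '' T)) =
      (red ι ψ I).colon (MvPolynomial.map ψ '' T)) := by
  classical
  induction T using Finset.induction_on with
  | empty =>
    refine ⟨1, one_ne_zero, fun k _ ψ _ _ => ?_⟩
    have h1 : ∀ {R : Type _} [CommRing R] (I : Ideal R), I.colon (∅ : Set R) = ⊤ := by
      intro R _ I
      rw [Ideal.eq_top_iff_one, mem_colon_iff]; simp
    have h2 : ∀ {R : Type _} [CommRing R] (I : Ideal R), I.colon (∅ : Set R) = ⊤ := by
      intro R _ I
      rw [Ideal.eq_top_iff_one, mem_colon_iff]; simp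
    simp only [Finset.coe_empty, Set.image_empty]
    rw [h1, h2, red_top]
  | insert g T hg ih =>
    have h1 : I.colon (MvPolynomial.map ι '' (insert g T : Finset _)) =
        I.colon {MvPolynomial.map ι g} ⊓ I.colon (MvPolynomial.map ι '' T) := by
      rw [Finset.coe_insert, Set.image_insert_eq, Set.insert_eq, Submodule.colon_union]
    rw [h1]
    refine ((gen_inter m hι hinj (I.colon {MvPolynomial.map ι g})
      (I.colon (MvPolynomial.map ι '' T))).and ((gen_colon_single m hι hinj I g).and ih)).mono ?_
    rintro k _ ψ - ⟨e1, e2, e3⟩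
    rw [e1, e2, e3]
    rw [Finset.coe_insert, Set.image_insert_eq, Set.insert_eq, Submodule.colon_union]

lemma gen_knutson (m : MonomialOrder σ) (hι : Good ι) (hinj : Function.Injective ι)
    (f : MvPolynomial σ A) (I : Ideal (MvPolynomial σ L))
    (hI : KnutsonFamily (MvPolynomial.map ι f) I) :
    Gen A (fun k _ ψ => KnutsonFamily (MvPolynomial.map ψ f) (red ι ψ I)) := by
  classical
  induction hI with
  | base =>
    refine (gen_base hι hinj f).mono ?_
    intro k _ ψ _ h
    rw [h]; exact .base
  | add I J _ _ hI hJ =>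
    refine ((gen_add hι hinj I J).and (hI.and hJ)).mono ?_
    rintro k _ ψ - ⟨h, h1, h2⟩
    rw [h]; exact .add _ _ h1 h2
  | inter I J _ _ hI hJ =>
    refine ((gen_inter m hι hinj I J).and (hI.and hJ)).mono ?_
    rintro k _ ψ - ⟨h, h1, h2⟩
    rw [h]; exact .inter _ _ h1 h2
  | colon I J _ hI =>
    obtain ⟨T, hT⟩ : (Ideal.comap (MvPolynomial.map ι) J).FG := IsNoetherian.noetherian _
    have hJ : J = Ideal.span (MvPolynomial.map ι '' T) := by
      apply le_antisymm
      · refine (le_map_comap hι J).trans ?_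
        rw [← hT]
        exact (Ideal.map_span _ _).le
      · rw [Ideal.span_le]
        rintro _ ⟨x, hx, rfl⟩
        have : x ∈ Ideal.comap (MvPolynomial.map ι) J := hT ▸ Ideal.subset_span hx
        exact this
    refine ((gen_colon_finset m hι hinj I T).and hI).mono ?_
    rintro k _ ψ - ⟨h, h1⟩
    rw [hJ, colon_span, h, ← colon_span]
    exact .colon _ _ h1

end Commute

section Frob

variable {σ : Type*} [Finite σ] {k : Type*} [Field k]

lemma exists_pi (k : Type*) [Field k] (p : ℕ) [hp : Fact p.Prime] [CharP k p] :
    ∃ π : k →+ k, (∀ c d, π (c ^ p * d) = c * π d) ∧ π 1 = 1 := by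
  let F := (frobenius k p).fieldRange
  let e : k ≃+* F := RingEquiv.ofBijective (frobenius k p).rangeRestrictField
    ⟨(frobenius k p).rangeRestrictField.injective, by
      rintro ⟨_, c, rfl⟩; exact ⟨c, rfl⟩⟩
  have he : ∀ c, (e c : k) = c ^ p := fun c => rfl
  obtain ⟨g, hg⟩ := LinearMap.exists_leftInverse_of_injective (Algebra.linearMap F k)
    (LinearMap.ker_eq_bot.2 (algebraMap F k).injective)
  refine ⟨(e.symm : F →+ k).comp (g : k →+ F), ?_, ?_⟩
  · intro c d
    have : c ^ p * d = e c • d := by rw [← he]; rfl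
    change e.symm (g _) = c * e.symm (g d)
    rw [this, map_smul, smul_eq_mul, map_mul, e.symm_apply_apply]
  · change e.symm (g 1) = 1
    have h1 := LinearMap.congr_fun hg 1
    have h2 : g 1 = 1 := by simpa using h1
    rw [h2, map_one]

/-- the constant exponent -/
noncomputable def cst (σ : Type*) [Finite σ] (q : ℕ) : σ →₀ ℕ :=
  Finsupp.equivFunOnFinite.symm fun _ => q

@[simp] lemma cst_apply (q : ℕ) (i : σ) : cst σ q i = q := rfl

lemma exists_trace (σ : Type*) [Finite σ] (k : Type*) [Field k] (p : ℕ) [hp : Fact p.Prime]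
    [CharP k p] :
    ∃ π : k →+ k, π 1 = 1 ∧ ∃ T : MvPolynomial σ k → MvPolynomial σ k,
      (∀ h c, coeff c (T h) = π (coeff (p • c + cst σ (p - 1)) h)) ∧
      (∀ h h', T (h + h') = T h + T h') ∧ ∀ g h, T (g ^ p * h) = g * T h := by
  classical
  obtain ⟨π, hπ, hπ1⟩ := exists_pi k p
  have hp0 : 0 < p := hp.out.pos
  let e : (σ →₀ ℕ) → (σ →₀ ℕ) := fun c => p • c + cst σ (p - 1)
  have he : Function.Injective e := by
    intro a b hab
    ext i
    have := DFunLike.congr_fun hab i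
    simp only [e, Finsupp.add_apply, Finsupp.smul_apply, smul_eq_mul, cst_apply] at this
    exact Nat.eq_of_mul_eq_mul_left hp0 (by omega)
  let T : MvPolynomial σ k → MvPolynomial σ k := fun h =>
    ∑ b ∈ h.support.preimage e he.injOn, monomial b (π (coeff (e b) h))
  have hT : ∀ h c, coeff c (T h) = π (coeff (e c) h) := by
    intro h c
    simp only [T, coeff_sum, coeff_monomial, Finset.sum_ite_eq']
    split_ifs with hc
    · rfl
    · rw [Finset.mem_preimage, notMem_support_iff] at hc
      rw [hc, map_zero]
  have hadd : ∀ h h', T (h + h') = T h + T h' := by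
    intro h h'
    ext c
    rw [coeff_add, hT, hT, hT, coeff_add, map_add]
  refine ⟨π, hπ1, T, hT, hadd, ?_⟩
  intro g h
  induction g using MvPolynomial.induction_on' with
  | monomial a c =>
    ext b
    rw [hT, monomial_pow, coeff_monomial_mul', coeff_monomial_mul', hT]
    have hiff : p • a ≤ e b ↔ a ≤ b := by
      rw [Finsupp.le_def, Finsupp.le_def]
      refine forall_congr' fun i => ?_
      simp only [e, Finsupp.add_apply, Finsupp.smul_apply, smul_eq_mul, cst_apply]
      constructor
      · intro hi
        have : p * a i < p * (b i + 1) := by rw [mul_add]; omega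
        have := Nat.lt_of_mul_lt_mul_left this
        omega
      · intro hi
        have := Nat.mul_le_mul_left p hi
        omega
    by_cases hab : a ≤ b
    · rw [if_pos hab, if_pos (hiff.2 hab), hπ]
      congr 3
      ext i
      have := hab i
      simp only [e, Finsupp.add_apply, Finsupp.smul_apply, smul_eq_mul, cst_apply,
        Finsupp.tsub_apply, Nat.mul_sub]
      have := Nat.mul_le_mul_left p this
      omega
    · rw [if_neg hab, if_neg (fun h => hab (hiff.1 h)), map_zero]
  | add u v hu hv =>
    haveI : CharP (MvPolynomial σ k) p := inferInstance
    rw [add_pow_char, add_mul, hadd, hu, hv, add_mul]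

lemma degs_radical_p (p : ℕ) [hp : Fact p.Prime] [CharP k p] (m : MonomialOrder σ)
    (f : MvPolynomial σ k) (hf0 : f ≠ 0) (hf : ∀ i, m.degree f i ≤ 1)
    (I : Ideal (MvPolynomial σ k)) (hI : KnutsonFamily f I) (r : ℕ) (a : σ →₀ ℕ)
    (ha : r • a ∈ degs m I) : a ∈ degs m I := by
  classical
  obtain ⟨π, hπ1, T, hT, hadd, hmul⟩ := exists_trace σ k p
  have hp0 : 0 < p := hp.out.pos
  set y : MvPolynomial σ k := monomial (cst σ 1 - m.degree f) 1 with hy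
  have hy0 : y ≠ 0 := by simp [hy]
  set F := f * y with hF
  have hF0 : F ≠ 0 := mul_ne_zero hf0 hy0
  have hFd : m.degree F = cst σ 1 := by
    rw [hF, m.degree_mul hf0 hy0, hy, m.degree_monomial, if_neg one_ne_zero]
    exact add_tsub_cancel_of_le (fun i => hf i)
  have hcompat : ∀ h ∈ I, T (F ^ (p - 1) * h) ∈ I := by
    clear ha
    induction hI with
    | base =>
      intro h hh
      obtain ⟨v, rfl⟩ := Ideal.mem_span_singleton.1 hh
      have : F ^ (p - 1) * (f * v) = f ^ p * (y ^ (p - 1) * v) := by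
        have : f ^ p = f ^ (p - 1) * f := by rw [← pow_succ, Nat.sub_add_cancel hp0]
        rw [this, hF, mul_pow]; ring
      rw [this, hmul]
      exact Ideal.mul_mem_right _ _ (Ideal.mem_span_singleton_self f)
    | colon I J _ ih =>
      intro h hh
      rw [mem_colon_iff] at hh ⊢
      intro j hj
      have := ih _ (I.mul_mem_left (j ^ (p - 1)) (hh j hj))
      have e : F ^ (p - 1) * (j ^ (p - 1) * (h * j)) = j ^ p * (F ^ (p - 1) * h) := by
        have : j ^ p = j ^ (p - 1) * j := by rw [← pow_succ, Nat.sub_add_cancel hp0]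
        rw [this]; ring
      rwa [e, hmul, mul_comm] at this
    | add I J _ _ hI hJ =>
      intro h hh
      obtain ⟨i, hi, j, hj, rfl⟩ := Submodule.mem_sup.1 hh
      rw [mul_add, hadd]
      exact Submodule.mem_sup.2 ⟨_, hI i hi, _, hJ j hj, rfl⟩
    | inter I J _ _ hI hJ =>
      intro h hh
      exact ⟨hI h hh.1, hJ h hh.2⟩
  -- one step
  have hstep : ∀ b, p • b ∈ degs m I → b ∈ degs m I := by
    rintro b ⟨g, hg, hg0, hgb⟩
    set q := F ^ (p - 1) * g with hq
    have hq0 : q ≠ 0 := mul_ne_zero (pow_ne_zero _ hF0) hg0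
    have hqd : m.degree q = p • b + cst σ (p - 1) := by
      rw [hq, m.degree_mul (pow_ne_zero _ hF0) hg0, m.degree_pow, hFd, hgb, add_comm]
      congr 1
      ext i; simp
    set c := m.leadingCoeff q with hc
    have hc0 : c ≠ 0 := by simpa [hc] using hq0
    have hmem := hcompat _ (I.mul_mem_left (C c⁻¹) hg)
    have e : F ^ (p - 1) * (C c⁻¹ * g) = C c⁻¹ * q := by rw [hq]; ring
    rw [e] at hmem
    have hcb : coeff b (T (C c⁻¹ * q)) = 1 := by
      rw [hT, coeff_C_mul, ← hqd]
      change π (c⁻¹ * c) = 1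
      rw [inv_mul_cancel₀ hc0, hπ1]
    refine ⟨_, hmem, fun h => by simp [h] at hcb, ?_⟩
    apply m.toSyn.injective
    apply le_antisymm
    · rw [m.degree_le_iff]
      intro d hd
      by_contra hlt
      rw [not_le] at hlt
      rw [mem_support_iff, hT, coeff_C_mul] at hd
      apply hd
      rw [m.coeff_eq_zero_of_lt, mul_zero, map_zero]
      rw [hqd, map_add, map_add, map_nsmul, map_nsmul]
      gcongr
    · apply m.le_degree
      rw [mem_support_iff, hcb]; exact one_ne_zero
  have hpow : ∀ e : ℕ, ∀ b, p ^ e • b ∈ degs m I → b ∈ degs m I := by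
    intro e
    induction e with
    | zero => intro b hb; simpa using hb
    | succ e ih =>
      intro b hb
      apply hstep
      apply ih
      rwa [← mul_smul, ← pow_succ]
  apply hpow r
  apply degs_upper m I ha
  intro i
  simp only [Finsupp.smul_apply, smul_eq_mul]
  exact Nat.mul_le_mul_right _ (Nat.lt_pow_self hp.out.one_lt).le

end Frob

section Primes

variable {A : Type u} [CommRing A] [IsDomain A] [CharZero A] [Algebra.FiniteType ℤ A]

lemma exists_prime (s : A) (hs : s ≠ 0) :
    ∃ p₀ : ℕ, ∀ p : ℕ, p₀ < p → p.Prime →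
      ∃ P ∈ (Ideal.span {(p : A)}).minimalPrimes, s ∉ P := by
  have : Algebra.FinitePresentation ℤ A := Algebra.FinitePresentation.of_finiteType.1 inferInstance
  have hop := PrimeSpectrum.isOpenMap_comap_of_hasGoingDown_of_finitePresentation (R := ℤ) (S := A)
  have hU := hop _ (PrimeSpectrum.basicOpen s).2
  set z : PrimeSpectrum A := ⟨⊥, Ideal.isPrime_bot⟩ with hz
  have hmem : PrimeSpectrum.comap (algebraMap ℤ A) z ∈
      PrimeSpectrum.comap (algebraMap ℤ A) '' (PrimeSpectrum.basicOpen s : Set _) :=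
    ⟨z, by simpa [hz, PrimeSpectrum.mem_basicOpen] using hs, rfl⟩
  obtain ⟨_, ⟨N, rfl⟩, hN1, hN2⟩ :=
    PrimeSpectrum.isTopologicalBasis_basic_opens.exists_subset_of_mem_open hmem hU
  have hN0 : N ≠ 0 := by
    rintro rfl
    simp at hN1
  refine ⟨N.natAbs, fun p hp hpr => ?_⟩
  have hpp : (Ideal.span {(p : ℤ)}).IsPrime :=
    (Ideal.span_singleton_prime (by exact_mod_cast hpr.ne_zero)).2 (Nat.prime_iff_prime_int.1 hpr)
  have hin : (⟨Ideal.span {(p : ℤ)}, hpp⟩ : PrimeSpectrum ℤ) ∈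
      (PrimeSpectrum.basicOpen N : Set (PrimeSpectrum ℤ)) := by
    change N ∉ Ideal.span {(p : ℤ)}
    rw [Ideal.mem_span_singleton]
    intro h
    have := Nat.le_of_dvd (Int.natAbs_pos.2 hN0) (Int.natCast_dvd.1 h)
    omega
  obtain ⟨Q, hQ, hQe⟩ := hN2 hin
  have hpQ : (p : A) ∈ Q.asIdeal := by
    have h1 : (p : ℤ) ∈ (PrimeSpectrum.comap (algebraMap ℤ A) Q).asIdeal := by
      rw [hQe]; exact Ideal.mem_span_singleton_self _
    simpa using h1
  obtain ⟨P, hP, hPQ⟩ := Ideal.exists_minimalPrimes_le (I := Ideal.span {(p : A)}) (J := Q.asIdeal)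
    (by rwa [Ideal.span_le, Set.singleton_subset_iff])
  exact ⟨P, hP, fun h => hQ (hPQ h)⟩

/-- the reduction homomorphism -/
noncomputable abbrev psi (P : Ideal A) : A →+* FractionRing (A ⧸ P) :=
  (algebraMap (A ⧸ P) (FractionRing (A ⧸ P))).comp (Ideal.Quotient.mk P)

lemma psi_eq_zero (P : Ideal A) [P.IsPrime] (s : A) : psi P s = 0 ↔ s ∈ P := by
  simp [psi, Ideal.Quotient.eq_zero_iff_mem]

lemma psi_good (P : Ideal A) [P.IsPrime] : Good (psi P) := by
  intro y
  obtain ⟨a, b, hb, rfl⟩ := IsFractionRing.div_surjective (A := A ⧸ P) y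
  obtain ⟨a, rfl⟩ := Ideal.Quotient.mk_surjective a
  obtain ⟨b, rfl⟩ := Ideal.Quotient.mk_surjective b
  have hb' : psi P b ≠ 0 := by
    intro h
    have h1 := (psi_eq_zero P b).1 h
    rw [← Ideal.Quotient.eq_zero_iff_mem] at h1
    exact nonZeroDivisors.ne_zero hb h1
  refine ⟨a, b, hb', ?_⟩
  exact mul_div_cancel₀ _ hb'

lemma Gen.primes {Q : ∀ (k : Type u) [Field k], (A →+* k) → Prop} (h : Gen A Q) :
    ∃ p₀ : ℕ, ∀ p : ℕ, p₀ < p → p.Prime →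
      ∃ P ∈ (Ideal.span {(p : A)}).minimalPrimes, ∃ _ : P.IsPrime,
        Q (FractionRing (A ⧸ P)) (psi P) := by
  obtain ⟨s, hs, h⟩ := h
  obtain ⟨p₀, hp₀⟩ := exists_prime s hs
  refine ⟨p₀, fun p hp hpr => ?_⟩
  obtain ⟨P, hP, hsP⟩ := hp₀ p hp hpr
  have := hP.1.1
  exact ⟨P, hP, this, h _ _ (psi_good P) (by rwa [Ne, psi_eq_zero])⟩

variable {σ : Type*} [Finite σ] {L : Type v} [Field L] {ι : A →+* L}

lemma degs_radical_zero (m : MonomialOrder σ) (hι : Good ι) (hinj : Function.Injective ι)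
    (f : MvPolynomial σ A) (hf0 : f ≠ 0) (hf : ∀ i, m.degree f i ≤ 1)
    (I : Ideal (MvPolynomial σ L)) (hI : KnutsonFamily (MvPolynomial.map ι f) I)
    (r : ℕ) (a : σ →₀ ℕ) (ha : r • a ∈ degs m I) : a ∈ degs m I := by
  have : IsNoetherianRing A := Algebra.FiniteType.isNoetherianRing ℤ A
  have hlc : m.leadingCoeff f ≠ 0 := by simpa using hf0
  obtain ⟨p₀, h⟩ := ((gen_knutson m hι hinj f I hI).and
    ((gen_degs m hι hinj I).and (Gen.ne hlc))).primes
  obtain ⟨p, hp, hpr⟩ := Nat.exists_infinite_primes (p₀ + 1)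
  obtain ⟨P, hP, hPp, h1, h2, h3⟩ := h p hp hpr
  have hpP : (p : A) ∈ P := hP.1.2 (Ideal.mem_span_singleton_self _)
  have : Fact p.Prime := ⟨hpr⟩
  have : CharP (FractionRing (A ⧸ P)) p := by
    rw [CharP.charP_iff_prime_eq_zero hpr]
    have := (psi_eq_zero P (p : A)).2 hpP
    rwa [map_natCast] at this
  rw [← h2] at ha ⊢
  have hdeg := degree_map_of_ne m (psi P) f h3
  refine degs_radical_p p m _ ?_ (by rwa [hdeg]) _ h1 r a ha
  intro e
  apply h3
  have := congrArg (coeff (m.degree f)) e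
  simpa [coeff_map, MonomialOrder.leadingCoeff] using this

end Primes

section Descent

variable {L K : Type*} [Field L] [Field K] [Algebra L K] {σ : Type*}

/-- The coefficientwise application of a linear functional. -/
noncomputable def Lam (l : K →ₗ[L] L) (u : MvPolynomial σ K) : MvPolynomial σ L :=
  ∑ b ∈ u.support, monomial b (l (coeff b u))

lemma coeff_Lam (l : K →ₗ[L] L) (u : MvPolynomial σ K) (d : σ →₀ ℕ) :
    coeff d (Lam l u) = l (coeff d u) := by
  classical
  simp only [Lam, coeff_sum, coeff_monomial, Finset.sum_ite_eq']
  split_ifs with hc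
  · rfl
  · rw [notMem_support_iff] at hc
    rw [hc, map_zero]

lemma Lam_add (l : K →ₗ[L] L) (u v : MvPolynomial σ K) : Lam l (u + v) = Lam l u + Lam l v := by
  ext d
  simp [coeff_Lam]

lemma Lam_zero (l : K →ₗ[L] L) : Lam l (0 : MvPolynomial σ K) = 0 := by
  ext d
  simp [coeff_Lam]

lemma Lam_sum {α : Type*} (l : K →ₗ[L] L) (T : Finset α) (u : α → MvPolynomial σ K) :
    Lam l (∑ i ∈ T, u i) = ∑ i ∈ T, Lam l (u i) := by
  ext d
  simp [coeff_Lam, coeff_sum]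

lemma Lam_map_mul (l : K →ₗ[L] L) (g : MvPolynomial σ L) (u : MvPolynomial σ K) :
    Lam l (MvPolynomial.map (algebraMap L K) g * u) = g * Lam l u := by
  classical
  ext d
  rw [coeff_Lam, coeff_mul, coeff_mul, map_sum]
  refine Finset.sum_congr rfl fun x _ => ?_
  rw [coeff_map, coeff_Lam, ← Algebra.smul_def, map_smul, smul_eq_mul]

lemma Lam_mem {I : Ideal (MvPolynomial σ L)} {u : MvPolynomial σ K}
    (hu : u ∈ Ideal.map (MvPolynomial.map (algebraMap L K)) I) (l : K →ₗ[L] L) : Lam l u ∈ I := by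
  refine Submodule.span_induction (p := fun u _ => ∀ l : K →ₗ[L] L, Lam l u ∈ I) ?_ ?_ ?_ ?_ hu l
  · rintro _ ⟨h, hh, rfl⟩ l
    have := Lam_map_mul l h (1 : MvPolynomial σ K)
    rw [mul_one] at this
    rw [this]
    exact I.mul_mem_right _ hh
  · intro l
    rw [Lam_zero]; exact I.zero_mem
  · intro x y _ _ hx hy l
    rw [Lam_add]
    exact I.add_mem (hx l) (hy l)
  · intro v x _ hx
    rw [smul_eq_mul]
    induction v using MvPolynomial.induction_on with
    | C c =>
      intro l
      have : Lam l (C c * x) = Lam (l.comp (LinearMap.mulLeft L c)) x := by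
        ext d
        simp [coeff_Lam, coeff_C_mul]
      rw [this]
      exact hx _
    | add p q hp hq =>
      intro l
      rw [add_mul, Lam_add]
      exact I.add_mem (hp l) (hq l)
    | mul_X p i hp =>
      intro l
      have : p * X i * x = MvPolynomial.map (algebraMap L K) (X i) * (p * x) := by
        rw [map_X]; ring
      rw [this, Lam_map_mul]
      exact I.mul_mem_left _ (hp l)

lemma decomp {κ : Type*} (b : Module.Basis κ L K) (u : MvPolynomial σ K) :
    ∃ T : Finset κ, u = ∑ i ∈ T, MvPolynomial.map (algebraMap L K) (Lam (b.coord i) u) *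
      C (b i) := by
  classical
  refine ⟨u.support.biUnion fun d => (b.repr (coeff d u)).support, ?_⟩
  ext d
  have hmC : ∀ (q : MvPolynomial σ K) (c : K), coeff d (q * C c) = coeff d q * c := by
    intro q c
    rw [mul_comm, coeff_C_mul, mul_comm]
  simp only [coeff_sum, hmC, coeff_map, coeff_Lam]
  by_cases hd : d ∈ u.support
  · conv_lhs => rw [← b.linearCombination_repr (coeff d u)]
    rw [Finsupp.linearCombination_apply, Finsupp.sum_of_support_subset]
    · refine Finset.sum_congr rfl fun i _ => ?_
      rw [Algebra.smul_def]; rfl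
    · intro i hi
      rw [Finset.mem_biUnion]
      exact ⟨d, hd, hi⟩
    · simp
  · rw [notMem_support_iff] at hd
    simp [hd]

lemma mem_map_iff {I : Ideal (MvPolynomial σ L)} {u : MvPolynomial σ K} :
    u ∈ Ideal.map (MvPolynomial.map (algebraMap L K)) I ↔ ∀ l : K →ₗ[L] L, Lam l u ∈ I := by
  refine ⟨fun h l => Lam_mem h l, fun h => ?_⟩
  obtain ⟨T, hT⟩ := decomp (Module.Basis.ofVectorSpace L K) u
  rw [hT]
  exact Ideal.sum_mem _ fun i _ => Ideal.mul_mem_right _ _ (Ideal.mem_map_of_mem _ (h _))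

lemma comap_map {I : Ideal (MvPolynomial σ L)} :
    Ideal.comap (MvPolynomial.map (algebraMap L K))
      (Ideal.map (MvPolynomial.map (algebraMap L K)) I) = I := by
  refine le_antisymm ?_ Ideal.le_comap_map
  intro h hh
  obtain ⟨l, hl⟩ := LinearMap.exists_leftInverse_of_injective (Algebra.linearMap L K)
    (LinearMap.ker_eq_bot.2 (algebraMap L K).injective)
  have h1 := Lam_mem hh l
  have : Lam l (MvPolynomial.map (algebraMap L K) h) = h := by
    ext d
    rw [coeff_Lam, coeff_map]
    exact LinearMap.congr_fun hl _
  rwa [this] at h1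

lemma map_inf (I J : Ideal (MvPolynomial σ L)) :
    Ideal.map (MvPolynomial.map (algebraMap L K)) (I ⊓ J) =
      Ideal.map (MvPolynomial.map (algebraMap L K)) I ⊓
        Ideal.map (MvPolynomial.map (algebraMap L K)) J := by
  ext u
  simp only [Ideal.mem_inf, mem_map_iff, forall_and]

lemma comap_colon (I : Ideal (MvPolynomial σ L)) (J : Ideal (MvPolynomial σ K)) :
    Ideal.comap (MvPolynomial.map (algebraMap L K))
      ((Ideal.map (MvPolynomial.map (algebraMap L K)) I).colon (J : Set (MvPolynomial σ K))) =
    I.colon (Ideal.span {h | ∃ j ∈ J, ∃ l : K →ₗ[L] L, h = Lam l j} : Set (MvPolynomial σ L)) := by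
  rw [colon_span]
  ext x
  rw [Ideal.mem_comap, mem_colon_iff, mem_colon_iff]
  constructor
  · rintro h _ ⟨j, hj, l, rfl⟩
    rw [← Lam_map_mul]
    exact Lam_mem (h j hj) l
  · intro h j hj
    rw [mem_map_iff]
    intro l
    rw [Lam_map_mul]
    exact h _ ⟨j, hj, l, rfl⟩

lemma prod_lead {R α : Type*} [CommRing R] (m : MonomialOrder σ) (a : σ →₀ ℕ) (s : Finset α)
    (P : α → MvPolynomial σ R) (hP : ∀ i ∈ s, m.degree (P i) ≼[m] a) :
    m.degree (∏ i ∈ s, P i) ≼[m] s.card • a ∧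
      coeff (s.card • a) (∏ i ∈ s, P i) = ∏ i ∈ s, coeff a (P i) := by
  classical
  induction s using Finset.induction_on with
  | empty => simp
  | insert i s hi ih =>
    obtain ⟨h1, h2⟩ := ih fun j hj => hP j (Finset.mem_insert_of_mem hj)
    have h3 := hP i (Finset.mem_insert_self _ _)
    have e : (insert i s).card • a = a + s.card • a := by
      rw [Finset.card_insert_of_notMem hi, add_smul, one_smul, add_comm]
    rw [e, Finset.prod_insert hi, Finset.prod_insert hi]
    constructor
    · refine m.degree_mul_le.trans ?_
      rw [map_add, map_add]
      exact add_le_add h3 h1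
    · rw [m.coeff_mul_of_add_of_degree_le h3 h1, h2]

lemma det_lead {R α : Type*} [CommRing R] [Fintype α] [DecidableEq α] (m : MonomialOrder σ)
    (a : σ →₀ ℕ) (M : Matrix α α (MvPolynomial σ R)) (hM : ∀ i j, m.degree (M i j) ≼[m] a)
    (hc : ∀ i j, coeff a (M i j) = if i = j then 1 else 0) :
    m.degree M.det ≼[m] Fintype.card α • a ∧ coeff (Fintype.card α • a) M.det = 1 := by
  have key := fun τ : Equiv.Perm α =>
    prod_lead m a Finset.univ (fun i => M (τ i) i) (fun i _ => hM _ _)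
  rw [Matrix.det_apply]
  constructor
  · refine m.degree_sum_le.trans (Finset.sup_le fun τ _ => ?_)
    refine le_trans ?_ (key τ).1
    rcases Int.units_eq_one_or (Equiv.Perm.sign τ) with h | h <;> simp [h]
  · have : (M.map (coeff a)) = 1 := by
      ext i j
      rw [Matrix.map_apply, hc, Matrix.one_apply]
    rw [coeff_sum, ← Matrix.det_one (n := α) (R := R), ← this, Matrix.det_apply]
    refine Finset.sum_congr rfl fun τ _ => ?_
    have := (key τ).2
    rw [Finset.card_univ] at this
    rcases Int.units_eq_one_or (Equiv.Perm.sign τ) with h | h <;> simp [h, this]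

lemma lead_single (m : MonomialOrder σ) (I : Ideal (MvPolynomial σ L)) (g j : MvPolynomial σ K)
    (hg0 : g ≠ 0) (hg : g * j ∈ Ideal.map (MvPolynomial.map (algebraMap L K)) I) :
    ∃ (r : ℕ) (ν : MvPolynomial σ L), ν ≠ 0 ∧ m.degree ν = r • m.degree g ∧
      MvPolynomial.map (algebraMap L K) ν * j ∈
        Ideal.map (MvPolynomial.map (algebraMap L K)) I := by
  classical
  wlog hmon : m.leadingCoeff g = 1 generalizing g
  · have hlc : m.leadingCoeff g ≠ 0 := by simpa using hg0
    have hC : (C (m.leadingCoeff g)⁻¹ : MvPolynomial σ K) ≠ 0 := by simpa using hg0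
    have hdeg : m.degree (C (m.leadingCoeff g)⁻¹ * g) = m.degree g := by
      rw [m.degree_mul hC hg0, m.degree_C, zero_add]
    have := this (C (m.leadingCoeff g)⁻¹ * g) (mul_ne_zero hC hg0)
      (by rw [mul_assoc]; exact Ideal.mul_mem_left _ _ hg)
      (by
        rw [MonomialOrder.leadingCoeff, hdeg, coeff_C_mul]
        exact inv_mul_cancel₀ hlc)
    rwa [hdeg] at this
  set b := Module.Basis.ofVectorSpace L K with hb
  obtain ⟨T, hT⟩ := decomp b j
  let M : Matrix T T (MvPolynomial σ L) := fun i k => Lam (b.coord i) (C (b k) * g)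
  have hdet := det_lead m (m.degree g) M
    (by
      intro i k
      rw [m.degree_le_iff]
      intro d hd
      by_contra hlt
      rw [not_le] at hlt
      rw [mem_support_iff, coeff_Lam, coeff_C_mul, m.coeff_eq_zero_of_lt hlt, mul_zero,
        map_zero] at hd
      exact hd rfl)
    (by
      intro i k
      have h1 : coeff (m.degree g) g = 1 := hmon
      rw [coeff_Lam, coeff_C_mul, h1, mul_one, Module.Basis.coord_apply, b.repr_self,
        Finsupp.single_apply]
      simp only [Subtype.ext_iff, eq_comm])
  refine ⟨Fintype.card T, M.det, ?_, ?_, ?_⟩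
  · intro h
    have := hdet.2
    rw [h] at this
    simp at this
  · apply m.toSyn.injective
    refine le_antisymm hdet.1 (m.le_degree ?_)
    rw [mem_support_iff, hdet.2]
    exact one_ne_zero
  · have hMv : ∀ i : T, ∑ k : T, M i k * Lam (b.coord k) j ∈ I := by
      intro i
      have : ∑ k : T, M i k * Lam (b.coord k) j = Lam (b.coord i) (g * j) := by
        conv_rhs => rw [hT]
        rw [Finset.mul_sum, Lam_sum, ← Finset.sum_coe_sort T]
        refine Finset.sum_congr rfl fun k _ => ?_
        rw [mul_left_comm, Lam_map_mul, mul_comm g, mul_comm]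
      rw [this]
      exact Lam_mem hg _
    have hν : ∀ k : T, M.det * Lam (b.coord k) j ∈ I := by
      intro k
      have h1 := congrFun (congrArg (fun N => Matrix.mulVec N fun k : T => Lam (b.coord k) j)
        (Matrix.adjugate_mul M)) k
      simp only [Matrix.smul_mulVec, Matrix.one_mulVec, Pi.smul_apply, smul_eq_mul] at h1
      rw [← h1, ← Matrix.mulVec_mulVec]
      exact Ideal.sum_mem _ fun i _ => I.mul_mem_left _ (hMv i)
    rw [hT, Finset.mul_sum]
    refine Ideal.sum_mem _ fun k hk => ?_
    rw [← mul_assoc, ← map_mul]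
    exact Ideal.mul_mem_right _ _ (Ideal.mem_map_of_mem _ (hν ⟨k, hk⟩))

lemma lead_finset (m : MonomialOrder σ) (I : Ideal (MvPolynomial σ L)) (g : MvPolynomial σ K)
    (hg0 : g ≠ 0) (G : Finset (MvPolynomial σ K))
    (hg : ∀ j ∈ G, g * j ∈ Ideal.map (MvPolynomial.map (algebraMap L K)) I) :
    ∃ (r : ℕ) (ν : MvPolynomial σ L), ν ≠ 0 ∧ m.degree ν = r • m.degree g ∧
      ∀ j ∈ G, MvPolynomial.map (algebraMap L K) ν * j ∈
        Ideal.map (MvPolynomial.map (algebraMap L K)) I := by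
  classical
  induction G using Finset.induction_on with
  | empty => exact ⟨0, 1, one_ne_zero, by simp, by simp⟩
  | insert j G hj ih =>
    obtain ⟨r, ν, h0, h1, h2⟩ := ih fun j hj => hg j (Finset.mem_insert_of_mem hj)
    obtain ⟨r', ν', h0', h1', h2'⟩ := lead_single m I g j hg0 (hg j (Finset.mem_insert_self _ _))
    refine ⟨r + r', ν * ν', mul_ne_zero h0 h0', by rw [m.degree_mul h0 h0', h1, h1', add_smul], ?_⟩
    intro i hi
    rw [map_mul]
    rcases Finset.mem_insert.1 hi with rfl | hi
    · rw [mul_assoc]; exact Ideal.mul_mem_left _ _ h2'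
    · rw [mul_right_comm]; exact Ideal.mul_mem_right _ _ (h2 i hi)

lemma le_map_comap_of_degs (m : MonomialOrder σ) (N : Ideal (MvPolynomial σ K))
    (h : degs m N ⊆ degs m (Ideal.comap (MvPolynomial.map (algebraMap L K)) N)) :
    N ≤ Ideal.map (MvPolynomial.map (algebraMap L K))
      (Ideal.comap (MvPolynomial.map (algebraMap L K)) N) := by
  have key : ∀ d : m.syn, ∀ u ∈ N, m.toSyn (m.degree u) = d →
      u ∈ Ideal.map (MvPolynomial.map (algebraMap L K))
        (Ideal.comap (MvPolynomial.map (algebraMap L K)) N) := by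
    intro d
    induction d using WellFoundedLT.induction with
    | ind d ih =>
    intro u hu hd
    by_cases hu0 : u = 0
    · rw [hu0]; exact Ideal.zero_mem _
    obtain ⟨w, hw, hw0, hwd⟩ := h ⟨u, hu, hu0, rfl⟩
    set v := MvPolynomial.map (algebraMap L K) w with hv
    have hvN : v ∈ N := hw
    have hvd : m.degree v = m.degree u := by
      rw [hv, degree_map_of_inj m (algebraMap L K).injective, hwd]
    have hv0 : v ≠ 0 := by
      rwa [hv, Ne, map_eq_zero_iff _ (map_injective _ (algebraMap L K).injective)]
    have hst := step m u v hvd.le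
    have hvm : v ∈ Ideal.map (MvPolynomial.map (algebraMap L K))
        (Ideal.comap (MvPolynomial.map (algebraMap L K)) N) := Ideal.mem_map_of_mem _ hw
    set h1 := C (m.leadingCoeff v) * u -
      monomial (m.degree u - m.degree v) (m.leadingCoeff u) * v with hh1
    have h1N : h1 ∈ N := N.sub_mem (N.mul_mem_left _ hu) (N.mul_mem_left _ hvN)
    have h1m : h1 ∈ Ideal.map (MvPolynomial.map (algebraMap L K))
        (Ideal.comap (MvPolynomial.map (algebraMap L K)) N) := by
      by_cases h10 : h1 = 0
      · rw [h10]; exact Ideal.zero_mem _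
      · exact ih _ (hd ▸ hst h10) h1 h1N rfl
    have hCm : C (m.leadingCoeff v) * u ∈ Ideal.map (MvPolynomial.map (algebraMap L K))
        (Ideal.comap (MvPolynomial.map (algebraMap L K)) N) := by
      have : C (m.leadingCoeff v) * u = h1 +
        monomial (m.degree u - m.degree v) (m.leadingCoeff u) * v := by rw [hh1]; ring
      rw [this]
      exact Ideal.add_mem _ h1m (Ideal.mul_mem_left _ _ hvm)
    exact mem_of_C_mul (by simpa using hv0) hCm
  exact fun u hu => key _ u hu rfl

/-- Knutson ideals are defined over the field of definition of `f`. -/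
lemma descent [Finite σ] (m : MonomialOrder σ) (f : MvPolynomial σ L)
    (hrad : ∀ I, KnutsonFamily f I → ∀ (r : ℕ) (a : σ →₀ ℕ), r • a ∈ degs m I → a ∈ degs m I)
    (I : Ideal (MvPolynomial σ K))
    (hI : KnutsonFamily (MvPolynomial.map (algebraMap L K) f) I) :
    ∃ I₀, KnutsonFamily f I₀ ∧ I = Ideal.map (MvPolynomial.map (algebraMap L K)) I₀ := by
  induction hI with
  | base =>
    refine ⟨_, KnutsonFamily.base, ?_⟩
    rw [Ideal.map_span, Set.image_singleton]
  | add I J _ _ hI hJ =>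
    obtain ⟨I₀, hI, rfl⟩ := hI
    obtain ⟨J₀, hJ, rfl⟩ := hJ
    refine ⟨_, KnutsonFamily.add _ _ hI hJ, ?_⟩
    exact (Ideal.map_sup _ _ _).symm
  | inter I J _ _ hI hJ =>
    obtain ⟨I₀, hI, rfl⟩ := hI
    obtain ⟨J₀, hJ, rfl⟩ := hJ
    exact ⟨_, KnutsonFamily.inter _ _ hI hJ, (map_inf _ _).symm⟩
  | colon I J _ hI =>
    obtain ⟨I₀, hI, rfl⟩ := hI
    have hN := comap_colon I₀ J
    have hK := KnutsonFamily.colon I₀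
      (Ideal.span {h | ∃ j ∈ J, ∃ l : K →ₗ[L] L, h = Lam l j}) hI
    rw [← hN] at hK
    refine ⟨_, hK, le_antisymm (le_map_comap_of_degs m _ ?_) Ideal.map_comap_le⟩
    rintro a ⟨g, hg, hg0, rfl⟩
    obtain ⟨G, hG⟩ := (inferInstance : IsNoetherianRing (MvPolynomial σ K)).noetherian J
    have hG' : J = Ideal.span (G : Set (MvPolynomial σ K)) := hG.symm
    rw [mem_colon_iff] at hg
    obtain ⟨r, ν, h0, h1, h2⟩ := lead_finset m I₀ g hg0 G
      (fun j hj => hg j (by rw [hG']; exact Ideal.subset_span hj))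
    apply hrad _ hK r
    refine ⟨ν, ?_, h0, h1⟩
    rw [Ideal.mem_comap, hG', colon_span, mem_colon_iff]
    exact h2

end Descent
end KR

/-- **Claim in the proof of Proposition 2.4.** Let `K` have characteristic `0`, let
`f ∈ S = K[x₁,…,xₙ]` have squarefree leading term, and let `A ⊆ K` be a finitely generated
`ℤ`-algebra containing the coefficients of `f` (i.e. `f` lifts to `f' ∈ A[x₁,…,xₙ]`).
If `I ∈ C_f`, then for all sufficiently large primes `p` there is a reduction modulo `p`
(a minimal prime `P` of `pA`) such that `I(p) ∈ C_{f(p)}`. -/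
theorem knutson_reduction_mod_p {n : ℕ} {K : Type*} [Field K] [CharZero K]
    (m : MonomialOrder (Fin n)) (A : Subalgebra ℤ K) (hA : A.FG)
    (f : MvPolynomial (Fin n) K) (hf : m.HasSqfreeLeadTerm f)
    (f' : MvPolynomial (Fin n) ↥A) (hf' : liftMap A f' = f)
    (I : Ideal (MvPolynomial (Fin n) K)) (hI : KnutsonFamily f I) :
    ∃ p₀ : ℕ, ∀ p : ℕ, p₀ < p → p.Prime →
      ∃ P ∈ (Ideal.span {(p : ↥A)}).minimalPrimes,
        KnutsonFamily (redMap A P f') (idealReduction A P I) := by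
  classical
  have hFT : Algebra.FiniteType ℤ ↥A := A.fg_iff_finiteType.1 hA
  have hN : IsNoetherianRing ↥A := Algebra.FiniteType.isNoetherianRing ℤ ↥A
  have hinjK : Function.Injective (algebraMap ↥A K) := Subtype.val_injective
  have hfaith : FaithfulSMul ↥A K := (faithfulSMul_iff_algebraMap_injective _ _).2 hinjK
  letI : Algebra (FractionRing ↥A) K := FractionRing.liftAlgebra ↥A K
  have hst : IsScalarTower ↥A (FractionRing ↥A) K := inferInstance
  set ι := algebraMap ↥A (FractionRing ↥A) with hι
  have hinj : Function.Injective ι := IsFractionRing.injective ↥A (FractionRing ↥A)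
  have hgood : KR.Good ι := by
    intro y
    obtain ⟨a, b, hb, rfl⟩ := IsFractionRing.div_surjective (A := ↥A) y
    have hb' : ι b ≠ 0 := by
      rw [Ne, map_eq_zero_iff _ hinj]
      exact nonZeroDivisors.ne_zero hb
    exact ⟨a, b, hb', mul_div_cancel₀ _ hb'⟩
  have hcomp : (algebraMap (FractionRing ↥A) K).comp ι = algebraMap ↥A K :=
    (IsScalarTower.algebraMap_eq ↥A (FractionRing ↥A) K).symm
  have hlift : ∀ h : MvPolynomial (Fin n) ↥A, liftMap A h =
      MvPolynomial.map (algebraMap (FractionRing ↥A) K) (MvPolynomial.map ι h) := by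
    intro h
    rw [MvPolynomial.map_map, hcomp]
    rfl
  have hdeg : m.degree f = m.degree f' := by
    rw [← hf']
    exact KR.degree_map_of_inj m hinjK f'
  have hf0 : f' ≠ 0 := by
    rintro rfl
    exact hf.1 (by rw [← hf', map_zero])
  have hsq : ∀ i, m.degree f' i ≤ 1 := by
    rw [← hdeg]
    exact hf.2
  obtain ⟨I₀, hI₀, rfl⟩ := KR.descent m (MvPolynomial.map ι f')
    (fun I hI r a ha => KR.degs_radical_zero m hgood hinj f' hf0 hsq I hI r a ha) I
    (by rw [← hlift, hf']; exact hI)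
  obtain ⟨p₀, h⟩ := (KR.gen_knutson m hgood hinj f' I₀ hI₀).primes
  refine ⟨p₀, fun p hp hpr => ?_⟩
  obtain ⟨P, hP, _, hk⟩ := h p hp hpr
  refine ⟨P, hP, ?_⟩
  have hcm : Ideal.comap (liftMap A)
      (Ideal.map (MvPolynomial.map (algebraMap (FractionRing ↥A) K)) I₀) =
      Ideal.comap (MvPolynomial.map ι) I₀ := by
    ext h
    rw [Ideal.mem_comap, hlift, ← Ideal.mem_comap, KR.comap_map, Ideal.mem_comap]
  rw [idealReduction, hcm]
  exact hk
end

section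
/- Let K be a field, n = 2m−1, and S = K[x₁,…,xₙ]. Let X be the m×m generic Hankel matrix with entries x₁,…,xₙ, let Q be the (m−1)×(m−1) Hankel matrix obtained from X by dropping the last row and the first column, and let f = det(X)·det(Q). Then, with respect to a diagonal term order, lt(f) = x₁x₂⋯xₙ is squarefree, and the determinantal ideal I_t(X) belongs to C_f for every t = 1,…,m. -/
open MvPolynomial

/-- `I_t(M)` : the ideal generated by the `t × t` minors of a matrix `M`. -/
noncomputable def minorsIdeal {R : Type*} [CommRing R] {r s : ℕ} (t : ℕ)
    (M : Matrix (Fin r) (Fin s) R) : Ideal R :=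
  Ideal.span {d | ∃ (ρ : Fin t → Fin r) (γ : Fin t → Fin s),
    StrictMono ρ ∧ StrictMono γ ∧ d = (M.submatrix ρ γ).det}

section SquareHankel

variable (K : Type*) [Field K] (m : ℕ)

/-- `X` : the generic `m × m` Hankel matrix with entries `x₁, …, x_{2m-1}`
(zero-indexed: entry `(i,j)` is `X (i+j)`). -/
noncomputable def hankelX : Matrix (Fin m) (Fin m) (MvPolynomial (Fin (2 * m - 1)) K) :=
  fun i j => MvPolynomial.X ⟨i.1 + j.1, by have := i.isLt; have := j.isLt; omega⟩

/-- `P₁` : the `(m-1) × m` Hankel matrix obtained from `X` by dropping the last row. -/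
noncomputable def hankelP1 : Matrix (Fin (m - 1)) (Fin m) (MvPolynomial (Fin (2 * m - 1)) K) :=
  fun i j => MvPolynomial.X ⟨i.1 + j.1, by have := i.isLt; have := j.isLt; omega⟩

/-- `P₂` : the `m × (m-1)` Hankel matrix obtained from `X` by dropping the first column. -/
noncomputable def hankelP2 : Matrix (Fin m) (Fin (m - 1)) (MvPolynomial (Fin (2 * m - 1)) K) :=
  fun i j => MvPolynomial.X ⟨i.1 + j.1 + 1, by have := i.isLt; have := j.isLt; omega⟩

/-- `Q` : the `(m-1) × (m-1)` Hankel matrix obtained from `X` by dropping the last row and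
the first column. -/
noncomputable def hankelQ :
    Matrix (Fin (m - 1)) (Fin (m - 1)) (MvPolynomial (Fin (2 * m - 1)) K) :=
  fun i j => MvPolynomial.X ⟨i.1 + j.1 + 1, by have := i.isLt; have := j.isLt; omega⟩

end SquareHankel


section Aux

open Finset

/-- The variable `x_i` with natural index (zero when out of range). -/
noncomputable def hx (K : Type*) [Field K] (n i : ℕ) : MvPolynomial (Fin n) K :=
  if h : i < n then X ⟨i, h⟩ else 0

/-- The Hankel minor with row shifts `ρ` and column shifts `γ`. -/
noncomputable def hminor (K : Type*) [Field K] (n : ℕ) {t : ℕ} (ρ γ : Fin t → ℕ) :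
    MvPolynomial (Fin n) K :=
  Matrix.det (Matrix.of fun i j => hx K n (ρ i + γ j))

/-- Parametrization of the `r`-secant variety in the variables `x_a, …, x_b`. -/
noncomputable def hphi (K : Type*) [Field K] (n r a b : ℕ) :
    MvPolynomial (Fin n) K →ₐ[K] MvPolynomial ((Fin r ⊕ Fin r) ⊕ Fin n) K :=
  aeval fun i => if a ≤ i.1 ∧ i.1 ≤ b then
    ∑ k : Fin r, X (Sum.inl (Sum.inl k)) * X (Sum.inl (Sum.inr k)) ^ i.1 else X (Sum.inr i)

/-- The prime ideal of Hankel `(r+1)`-minors in the variables `x_a, …, x_b`. -/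
noncomputable def hJ (K : Type*) [Field K] (n r a b : ℕ) : Ideal (MvPolynomial (Fin n) K) :=
  RingHom.ker (hphi K n r a b)

variable {K : Type*} [Field K] {n : ℕ}

lemma hJ_prime (r a b : ℕ) : (hJ K n r a b).IsPrime := RingHom.ker_isPrime _

lemma det_lowrank {R : Type*} [CommRing R] {r : ℕ} (A : Fin (r+1) → Fin r → R)
    (B : Fin r → Fin (r+1) → R) :
    Matrix.det (Matrix.of fun i j => ∑ k, A i k * B k j) = 0 := by
  have h : (Matrix.of fun i j => ∑ k, A i k * B k j) =
      (Matrix.of fun i => Fin.snoc (α := fun _ => R) (A i) 0) *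
        (Matrix.of (Fin.snoc (α := fun _ => Fin (r+1) → R) B 0) :
          Matrix (Fin (r+1)) (Fin (r+1)) R) := by
    ext i j
    simp [Matrix.mul_apply, Fin.sum_univ_castSucc]
  rw [h, Matrix.det_mul, Matrix.det_eq_zero_of_column_eq_zero (Fin.last r), zero_mul]
  intro i
  simp

lemma hphi_hx {r a b i : ℕ} (hb : b < n) (ha : a ≤ i) (hi : i ≤ b) :
    hphi K n r a b (hx K n i) =
      ∑ k : Fin r, X (Sum.inl (Sum.inl k)) * X (Sum.inl (Sum.inr k)) ^ i := by
  have : i < n := by omega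
  simp [hphi, hx, this, ha, hi]

lemma hminor_mem {r a b : ℕ} (hb : b < n) (ρ γ : Fin (r+1) → ℕ)
    (h : ∀ i j, a ≤ ρ i + γ j ∧ ρ i + γ j ≤ b) : hminor K n ρ γ ∈ hJ K n r a b := by
  rw [hJ, RingHom.mem_ker, hminor, AlgHom.map_det]
  rw [← det_lowrank (r := r)
    (fun i k => (X (Sum.inl (Sum.inl k)) * X (Sum.inl (Sum.inr k)) ^ ρ i :
      MvPolynomial ((Fin r ⊕ Fin r) ⊕ Fin n) K))
    (fun k j => X (Sum.inl (Sum.inr k)) ^ γ j)]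
  congr 1
  ext1 i j
  simp only [AlgHom.mapMatrix_apply, Matrix.map_apply, Matrix.of_apply]
  rw [hphi_hx hb (h i j).1 (h i j).2]
  refine Finset.sum_congr rfl fun k _ => ?_
  ring

/-- Greedy chain / cover dichotomy. -/
lemma chain_or_cover (r : ℕ) : ∀ (L M : ℕ) (U : Finset ℕ), (∀ u ∈ U, L ≤ u ∧ u ≤ M) → L ≤ M + 2 →
    (∃ c : Fin (r+1) → ℕ, (∀ i, c i ∈ U) ∧ ∀ i j, i < j → c i + 2 ≤ c j) ∨
    (∃ p : Fin r → ℕ, (∀ i, L ≤ p i ∧ p i ≤ M + 2 * r) ∧ (∀ i j, i < j → p i + 2 ≤ p j) ∧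
      ∀ u ∈ U, ∃ k, u = p k ∨ u = p k + 1) := by
  induction r with
  | zero =>
    intro L M U hU _
    rcases U.eq_empty_or_nonempty with rfl | ⟨u, hu⟩
    · right
      exact ⟨fun _ => 0, fun i => i.elim0, fun i => i.elim0, by simp⟩
    · left
      exact ⟨fun _ => u, fun _ => hu, fun i j hij => by omega⟩
  | succ r ih =>
    intro L M U hU hLM
    rcases U.eq_empty_or_nonempty with rfl | hne
    · right
      refine ⟨fun i => L + 2 * i.1, fun i => ?_, fun i j hij => ?_, by simp⟩
      · have := i.2
        dsimp only
        omega
      · have : i.1 < j.1 := hij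
        dsimp only
        omega
    · set u := U.min' hne with hu
      have huU : u ∈ U := U.min'_mem hne
      have hmin : ∀ v ∈ U, u ≤ v := fun v hv => U.min'_le v hv
      have h1 := hU u huU
      rcases ih (u+2) M (U.filter (u + 2 ≤ ·)) (fun v hv => by
        rw [Finset.mem_filter] at hv
        exact ⟨hv.2, (hU v hv.1).2⟩) (by omega) with ⟨c, hc, hc2⟩ | ⟨p, hp, hp2, hp3⟩
      · left
        refine ⟨Fin.cons u c, ?_, ?_⟩
        · intro i
          refine Fin.cases ?_ (fun i => ?_) i
          · simpa using huU
          · simpa using (Finset.mem_filter.1 (hc i)).1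
        · intro i j
          refine Fin.cases ?_ (fun i => ?_) i <;> refine Fin.cases ?_ (fun j => ?_) j
          · simp
          · intro _
            simpa using (Finset.mem_filter.1 (hc j)).2
          · simp
          · intro h
            simpa using hc2 i j (by simpa using h)
      · right
        refine ⟨Fin.cons u p, ?_, ?_, ?_⟩
        · intro i
          refine Fin.cases ?_ (fun i => ?_) i
          · simp only [Fin.cons_zero]
            omega
          · simp only [Fin.cons_succ]
            have := hp i
            omega
        · intro i j
          refine Fin.cases ?_ (fun i => ?_) i <;> refine Fin.cases ?_ (fun j => ?_) j
          · simp
          · intro _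
            simpa using (hp j).1
          · simp
          · intro h
            simpa using hp2 i j (by simpa using h)
        · intro v hv
          have := hmin v hv
          by_cases h2 : u + 2 ≤ v
          · obtain ⟨k, hk⟩ := hp3 v (Finset.mem_filter.2 ⟨hv, h2⟩)
            exact ⟨k.succ, by simpa using hk⟩
          · exact ⟨0, by simp only [Fin.cons_zero]; omega⟩

lemma torus0 {F : Type*} [Field F] {y z : F} (hy : y ≠ 0) (hz : z ≠ 0) (q : ℕ) :
    y ^ (q + 1) / z ^ q * (z / y) ^ q = y := by
  rw [div_pow]
  field_simp
  ring

lemma torus1 {F : Type*} [Field F] {y z : F} (hy : y ≠ 0) (hz : z ≠ 0) (q : ℕ) :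
    y ^ (q + 1) / z ^ q * (z / y) ^ (q + 1) = z := by
  rw [div_pow]
  field_simp
  ring

lemma degen_standard {r a b : ℕ} (hb : b < n) (g : MvPolynomial (Fin n) K)
    (hg : g ∈ hJ K n r a b)
    (hst : ∀ e ∈ g.support, ¬ ∃ c : Fin (r+1) → ℕ,
      (∀ i, a ≤ c i ∧ c i ≤ b ∧ ∃ h : c i < n, e ⟨c i, h⟩ ≠ 0) ∧
        ∀ i j, i < j → c i + 2 ≤ c j) : g = 0 := by
  classical
  by_contra hne
  set L : ℕ := 2 * (n + 2 * r) + 2 with hL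
  set ω : ℕ → ℕ := fun i => L * i - i * i with hω
  set wt : (Fin n →₀ ℕ) → ℕ := fun e => ∑ i : Fin n, ω i.1 * e i with hwt
  obtain ⟨e₀, he₀, hmin⟩ := Finset.exists_min_image g.support wt
    (by rwa [MvPolynomial.support_nonempty])
  set U : Finset ℕ := (Finset.univ.filter
    (fun i : Fin n => e₀ i ≠ 0 ∧ a ≤ i.1 ∧ i.1 ≤ b)).image Fin.val with hU
  have hUm : ∀ u, u ∈ U ↔ a ≤ u ∧ u ≤ b ∧ ∃ h : u < n, e₀ ⟨u, h⟩ ≠ 0 := by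
    intro u
    simp only [hU, Finset.mem_image, Finset.mem_filter, Finset.mem_univ, true_and]
    constructor
    · rintro ⟨i, ⟨h1, h2, h3⟩, rfl⟩
      exact ⟨h2, h3, i.2, h1⟩
    · rintro ⟨h1, h2, h3, h4⟩
      exact ⟨⟨u, h3⟩, ⟨h4, h1, h2⟩, rfl⟩
  rcases chain_or_cover r 0 n U (fun u hu => ⟨Nat.zero_le _, by
      have := (hUm u).1 hu
      omega⟩) (by omega) with ⟨c, hc, hc2⟩ | ⟨p, hp, hp2, hp3⟩
  · exact hst e₀ he₀ ⟨c, fun i => (hUm _).1 (hc i), hc2⟩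
  let S := MvPolynomial (Fin n) K
  let F := FractionRing S
  let bad : Fin n → Prop := fun i => (a ≤ i.1 ∧ i.1 ≤ b) ∧ ¬ ∃ k, i.1 = p k ∨ i.1 = p k + 1
  let Y : ℕ → F := fun i => if h : i < n then algebraMap S F (X ⟨i, h⟩) else 1
  have hY : ∀ i, Y i ≠ 0 := by
    intro i
    by_cases h : i < n
    · simp only [Y, h, dif_pos]
      exact (map_ne_zero_iff _ (FaithfulSMul.algebraMap_injective S F)).2 (X_ne_zero _)
    · simp [Y, h]
  let u : Fin r → F := fun k => Y (p k) ^ (p k + 1) / Y (p k + 1) ^ (p k)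
  let v : Fin r → F := fun k => Y (p k + 1) / Y (p k)
  let q : ℕ → ℕ → ℕ := fun i s => (i - s) * (i - s - 1) + (s - i) * (s + 1 - i)
  have huv0 : ∀ k, u k * v k ^ (p k) = Y (p k) := by
    intro k
    exact torus0 (hY (p k)) (hY (p k + 1)) _
  have huv1 : ∀ k, u k * v k ^ (p k + 1) = Y (p k + 1) := by
    intro k
    exact torus1 (hY (p k)) (hY (p k + 1)) _
  let Ψ : MvPolynomial ((Fin r ⊕ Fin r) ⊕ Fin n) K →ₐ[K] Polynomial F :=
    aeval (Sum.elim (Sum.elim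
      (fun k => Polynomial.C (u k) * Polynomial.X ^ (p k * (p k + 1)))
      (fun k => Polynomial.C (v k) * Polynomial.X ^ (L - 2 * p k - 1)))
      (fun i => Polynomial.C (Y i.1) * Polynomial.X ^ (ω i.1)))
  let P : Fin n → Polynomial F := fun i => if a ≤ i.1 ∧ i.1 ≤ b then
    ∑ k : Fin r, Polynomial.C (u k * v k ^ i.1) * Polynomial.X ^ (q i.1 (p k))
    else Polynomial.C (Y i.1)
  have hexp : ∀ (i : Fin n) k, p k * (p k + 1) + (L - 2 * p k - 1) * i.1 =
      ω i.1 + q i.1 (p k) := by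
    intro i k
    have h1 := i.2
    have h2 := (hp k).2
    simp only [hω, q]
    generalize i.1 = x at *
    generalize p k = s at *
    obtain ⟨D, hD⟩ : ∃ D, L = 2 * s + 1 + D := ⟨L - 2 * s - 1, by omega⟩
    obtain ⟨E, hE⟩ : ∃ E, L = x + E := ⟨L - x, by omega⟩
    have e1 : L - 2 * s - 1 = D := by omega
    have e2 : L * x - x * x = E * x := by
      rw [hE, add_mul, Nat.add_sub_cancel_left]
    rw [e1, e2]
    rcases le_or_gt x s with h | h
    · obtain ⟨w, rfl⟩ := Nat.exists_eq_add_of_le h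
      have e3 : x - (x + w) = 0 := by omega
      have e4 : x + w - x = w := by omega
      have e5 : x + w + 1 - x = w + 1 := by omega
      rw [e3, e4, e5]
      have e6 : E = x + 2 * w + 1 + D := by omega
      rw [e6]
      ring
    · obtain ⟨w, rfl⟩ := Nat.exists_eq_add_of_lt h
      have e3 : s + w + 1 - s = w + 1 := by omega
      have e4 : s - (s + w + 1) = 0 := by omega
      rw [e3, e4, Nat.add_sub_cancel]
      have e6 : E + w = s + D := by omega
      zify at e6 ⊢
      have e7 : (E : ℤ) = s + D - w := by linarith
      rw [e7]
      ring
  have hΨ : ∀ i : Fin n, Ψ (hphi K n r a b (X i)) = Polynomial.X ^ (ω i.1) * P i := by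
    intro i
    simp only [hphi, aeval_X, P]
    split_ifs with h
    · rw [map_sum, Finset.mul_sum]
      refine Finset.sum_congr rfl fun k _ => ?_
      simp only [Ψ, map_mul, map_pow, aeval_X, Sum.elim_inl, Sum.elim_inr]
      rw [mul_pow, ← pow_mul]
      calc _ = (Polynomial.C (u k) * Polynomial.C (v k) ^ i.1) *
            Polynomial.X ^ (p k * (p k + 1) + (L - 2 * p k - 1) * i.1) := by
            rw [pow_add]
            ring
        _ = _ := by
            rw [hexp, pow_add]
            ring
    · simp only [Ψ, aeval_X, Sum.elim_inr]
      ring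
  have hq : ∀ i s, q i s = 0 ↔ i = s ∨ i = s + 1 := by
    intro i s
    simp only [q, Nat.add_eq_zero_iff, Nat.mul_eq_zero]
    omega
  have hP : ∀ i : Fin n, (P i).eval 0 = algebraMap S F (if bad i then 0 else X i) := by
    intro i
    have hYi : Y i.1 = algebraMap S F (X i) := by simp [Y]
    by_cases hab : a ≤ i.1 ∧ i.1 ≤ b
    · simp only [P, hab, and_self, if_true, Polynomial.eval_finsetSum, Polynomial.eval_mul,
        Polynomial.eval_C, Polynomial.eval_pow, Polynomial.eval_X, bad]
      split_ifs with h
      · rw [map_zero]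
        refine Finset.sum_eq_zero fun k _ => ?_
        rw [zero_pow, mul_zero]
        rw [Ne, hq]
        rintro hk
        exact h.2 ⟨k, hk⟩
      · simp only [true_and, not_not] at h
        obtain ⟨k, hk⟩ := h
        rw [Finset.sum_eq_single k]
        · rw [(hq _ _).2 hk, pow_zero, mul_one, ← hYi]
          rcases hk with hk | hk
          · rw [hk, huv0]
          · rw [hk, huv1]
        · intro l _ hl
          rw [zero_pow, mul_zero]
          rw [Ne, hq]
          intro hl'
          rcases lt_or_gt_of_ne hl with h | h
          · have := hp2 _ _ h
            omega
          · have := hp2 _ _ h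
            omega
        · simp
    · simp [P, hab, bad, hYi]
  have h0 : Ψ (hphi K n r a b g) = 0 := by
    rw [show hphi K n r a b g = 0 from hg, map_zero]
  have h1 : Ψ (hphi K n r a b g) = Polynomial.X ^ (wt e₀) *
      ∑ e ∈ g.support, Polynomial.X ^ (wt e - wt e₀) *
        (algebraMap K (Polynomial F) (g.coeff e) * ∏ i, P i ^ e i) := by
    have h2 : Ψ (hphi K n r a b g) = aeval (fun i => Polynomial.X ^ (ω i.1) * P i) g := by
      have : Ψ.comp (hphi K n r a b) = aeval (fun i => Polynomial.X ^ (ω i.1) * P i) := by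
        apply MvPolynomial.algHom_ext
        intro i
        rw [aeval_X, AlgHom.comp_apply, hΨ]
      rw [← this, AlgHom.comp_apply]
    rw [h2, aeval_def, eval₂_eq', Finset.mul_sum]
    refine Finset.sum_congr rfl fun e he => ?_
    rw [← mul_assoc, ← pow_add, Nat.add_sub_cancel' (hmin e he)]
    simp only [mul_pow, Finset.prod_mul_distrib, hwt, ← pow_mul]
    rw [Finset.prod_pow_eq_pow_sum]
    ring
  rw [h1] at h0
  have h2 := (mul_eq_zero.1 h0).resolve_left (pow_ne_zero _ Polynomial.X_ne_zero)
  have h3 := congrArg (Polynomial.eval 0) h2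
  have h4 : algebraMap S F (∑ e ∈ g.support, if wt e = wt e₀ then
      C (g.coeff e) * ∏ i, (if bad i then 0 else X i) ^ e i else 0) = 0 := by
    rw [← Polynomial.eval_zero (x := (0:F)), ← h3, Polynomial.eval_finsetSum, map_sum]
    refine Finset.sum_congr rfl fun e he => ?_
    rw [Polynomial.eval_mul, Polynomial.eval_mul, Polynomial.eval_pow, Polynomial.eval_X,
      Polynomial.eval_prod]
    simp only [Polynomial.eval_pow, hP]
    have hle := hmin e he
    split_ifs with hw
    · rw [hw, Nat.sub_self, pow_zero, one_mul, map_mul, map_prod]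
      simp only [map_pow]
      congr 1
      rw [IsScalarTower.algebraMap_apply K F (Polynomial F), Polynomial.algebraMap_eq,
        Polynomial.eval_C, IsScalarTower.algebraMap_apply K S F]
      rfl
    · rw [zero_pow (by omega), zero_mul, map_zero]
  have h5 := (FaithfulSMul.algebraMap_injective S F) (h4.trans (map_zero _).symm)
  have h6 := congrArg (coeff e₀) h5
  have h7 : ∀ e, coeff e₀ (∏ i, (if bad i then (0 : S) else X i) ^ e i) =
      if e = e₀ then 1 else 0 := by
    intro e
    by_cases hbad : ∃ i, bad i ∧ e i ≠ 0
    · obtain ⟨i, hi, hei⟩ := hbad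
      rw [Finset.prod_eq_zero (Finset.mem_univ i) (by rw [if_pos hi, zero_pow hei]), coeff_zero]
      rw [if_neg]
      rintro rfl
      obtain ⟨k, hk⟩ := hp3 i.1 ((hUm _).2 ⟨hi.1.1, hi.1.2, i.2, hei⟩)
      exact hi.2 ⟨k, hk⟩
    · push Not at hbad
      have : (∏ i, (if bad i then (0 : S) else X i) ^ e i) = monomial e 1 := by
        rw [monomial_eq, C_1, one_mul, Finsupp.prod_fintype _ _ (by simp)]
        refine Finset.prod_congr rfl fun i _ => ?_
        split_ifs with h
        · rw [hbad i h, pow_zero, pow_zero]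
        · rfl
      rw [this, coeff_monomial]
  rw [coeff_sum, Finset.sum_eq_single e₀] at h6
  · rw [if_pos rfl, coeff_C_mul, h7, if_pos rfl, mul_one, coeff_zero] at h6
    exact (mem_support_iff.1 he₀) h6
  · intro e _ hne'
    split_ifs
    · rw [coeff_C_mul, h7, if_neg hne', mul_zero]
    · exact coeff_zero _
  · intro h
    exact absurd he₀ h

lemma mono_sum_lt {t : ℕ} (ρ γ : Fin t → ℕ) (hρ : StrictMono ρ) (hγ : StrictMono γ)
    (σ : Equiv.Perm (Fin t)) (hσ : σ ≠ 1) :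
    ∑ k, (ρ (σ k) + γ k) ^ 2 < ∑ k, (ρ k + γ k) ^ 2 := by
  have h1 : ∑ k, ρ (σ k) * γ k < ∑ k, ρ k * γ k := by
    have hm : Monovary ρ γ := fun i j h => hρ.monotone (hγ.lt_iff_lt.1 h).le
    rw [hm.sum_comp_perm_mul_lt_sum_mul_iff]
    intro h
    apply hσ
    have hmono : StrictMono σ := by
      intro i j hij
      have h2 := h (hγ hij)
      have h3 : σ i ≤ σ j := hρ.le_iff_le.1 h2
      exact lt_of_le_of_ne h3 (fun h4 => hij.ne (σ.injective h4))
    ext i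
    have := hmono.range_inj (strictMono_id (α := Fin t))
    have h5 : (σ : Fin t → Fin t) = id := by
      rw [← this]
      simp [σ.surjective.range_eq]
    simp [h5]
  have h2 : ∑ k, ρ (σ k) ^ 2 = ∑ k, ρ k ^ 2 := Equiv.sum_comp σ (fun k => ρ k ^ 2)
  have h3 : ∀ τ : Equiv.Perm (Fin t), ∑ k, (ρ (τ k) + γ k) ^ 2 =
      ∑ k, ρ (τ k) ^ 2 + 2 * ∑ k, ρ (τ k) * γ k + ∑ k, γ k ^ 2 := by
    intro τ
    rw [Finset.mul_sum, ← Finset.sum_add_distrib, ← Finset.sum_add_distrib]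
    refine Finset.sum_congr rfl fun k _ => ?_
    ring
  have h4 := h3 1
  simp only [Equiv.Perm.coe_one, id_eq] at h4
  rw [h3, h4, h2]
  omega

lemma hx_eq {i : ℕ} (h : i < n) : hx K n i = X ⟨i, h⟩ := by simp [hx, h]

lemma prod_hx {t : ℕ} (d : Fin t → ℕ) (h : ∀ k, d k < n) :
    ∏ k, hx K n (d k) = monomial (∑ k, Finsupp.single (⟨d k, h k⟩ : Fin n) 1) 1 := by
  rw [monomial_sum_one]
  refine Finset.prod_congr rfl fun k _ => ?_
  rw [hx_eq (h k)]
  rfl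

lemma hJ_le_of_chains {r a b : ℕ} (hb : b < n) (I : Ideal (MvPolynomial (Fin n) K))
    (hI : ∀ c : Fin (r+1) → ℕ, (∀ i, a ≤ c i ∧ c i ≤ b) → (∀ i j, i < j → c i + 2 ≤ c j) →
      ∃ ρ γ : Fin (r+1) → ℕ, StrictMono ρ ∧ StrictMono γ ∧ (∀ k, ρ k + γ k = c k) ∧
        hminor K n ρ γ ∈ I) : hJ K n r a b ≤ I := by
  classical
  set I' := I ⊓ hJ K n r a b with hI'
  set St : Set (Fin n →₀ ℕ) := {e | ¬ ∃ c : Fin (r+1) → ℕ,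
      (∀ i, a ≤ c i ∧ c i ≤ b ∧ ∃ h : c i < n, e ⟨c i, h⟩ ≠ 0) ∧
        ∀ i j, i < j → c i + 2 ≤ c j} with hSt
  set N : Submodule K (MvPolynomial (Fin n) K) :=
    (I'.restrictScalars K) ⊔ restrictSupport K St with hN
  set wt : (Fin n →₀ ℕ) → ℕ := fun e => ∑ i : Fin n, e i * i.1 ^ 2 with hwt
  have wt_add : ∀ e f, wt (e + f) = wt e + wt f := by
    intro e f
    simp [hwt, add_mul, Finset.sum_add_distrib]
  have wt_sum : ∀ (d : Fin (r+1) → Fin n), wt (∑ k, Finsupp.single (d k) 1) =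
      ∑ k, (d k).1 ^ 2 := by
    intro d
    simp only [hwt, Finsupp.coe_finsetSum, Finset.sum_apply, Finset.sum_mul]
    rw [Finset.sum_comm]
    refine Finset.sum_congr rfl fun k _ => ?_
    rw [Finset.sum_eq_single (d k)]
    · simp
    · intro i _ hi
      simp [hi.symm]
    · simp
  have key : ∀ M : ℕ, ∀ e, wt e = M → (monomial e (1 : K)) ∈ N := by
    intro M
    induction M using Nat.strong_induction_on with
    | _ M ih =>
    intro e he
    by_cases hes : e ∈ St
    · apply Submodule.mem_sup_right
      rw [mem_restrictSupport_iff]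
      intro d hd
      have := support_monomial_subset hd
      simp only [Finset.mem_singleton] at this
      rwa [this]
    · simp only [hSt, Set.mem_ofPred_eq, not_not] at hes
      obtain ⟨c, hc, hc2⟩ := hes
      obtain ⟨ρ, γ, hρ, hγ, hsum, hmem⟩ := hI c (fun i => ⟨(hc i).1, (hc i).2.1⟩) hc2
      have hrange : ∀ i j, a ≤ ρ i + γ j ∧ ρ i + γ j ≤ b := by
        intro i j
        have h1 := hρ.monotone (Fin.zero_le i)
        have h2 := hγ.monotone (Fin.zero_le j)
        have h3 := hρ.monotone (Fin.le_last i)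
        have h4 := hγ.monotone (Fin.le_last j)
        have h5 := hsum 0
        have h6 := hsum (Fin.last r)
        have h7 := hc 0
        have h8 := hc (Fin.last r)
        omega
      have hrn : ∀ i j, ρ i + γ j < n := fun i j => lt_of_le_of_lt (hrange i j).2 hb
      have hmem' : hminor K n ρ γ ∈ I' := ⟨hmem, hminor_mem hb ρ γ hrange⟩
      have hcn : ∀ i, c i < n := fun i => (hc i).2.2.1
      have hcinj : Function.Injective c := by
        intro i j hij
        rcases lt_trichotomy i j with h | h | h
        · have := hc2 _ _ h
          omega
        · exact h
        · have := hc2 _ _ h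
          omega
      have hle : (∑ k, Finsupp.single (⟨c k, hcn k⟩ : Fin n) 1) ≤ e := by
        intro i
        simp only [Finsupp.coe_finsetSum, Finset.sum_apply]
        by_cases h : ∃ k, c k = i.1
        · obtain ⟨k, hk⟩ := h
          have hki : (⟨c k, hcn k⟩ : Fin n) = i := Fin.ext hk
          rw [Finset.sum_eq_single k]
          · rw [hki, Finsupp.single_eq_same]
            obtain ⟨_, _, h1, h2⟩ := hc k
            rw [hki] at h2
            omega
          · intro l _ hl
            rw [Finsupp.single_apply, if_neg]
            intro h
            exact hl (hcinj ((Fin.ext_iff.1 h).trans hk.symm))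
          · simp
        · push Not at h
          rw [Finset.sum_eq_zero]
          · exact Nat.zero_le _
          · intro k _
            rw [Finsupp.single_apply, if_neg]
            intro h'
            exact h k (Fin.ext_iff.1 h')
      obtain ⟨e', rfl⟩ := exists_add_of_le hle
      set D : Equiv.Perm (Fin (r+1)) → (Fin n →₀ ℕ) := fun σ =>
        ∑ k, Finsupp.single (⟨ρ (σ k) + γ k, hrn _ _⟩ : Fin n) 1 with hD
      have hD1 : (∑ k, Finsupp.single (⟨c k, hcn k⟩ : Fin n) 1) = D 1 := by
        simp only [hD]
        refine Finset.sum_congr rfl fun k _ => ?_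
        simp [hsum]
      rw [hD1] at he ⊢
      have hdet : hminor K n ρ γ = ∑ σ : Equiv.Perm (Fin (r+1)),
          Equiv.Perm.sign σ • monomial (D σ) (1 : K) := by
        rw [hminor, Matrix.det_apply]
        refine Finset.sum_congr rfl fun σ _ => ?_
        congr 1
        exact prod_hx (fun k => ρ (σ k) + γ k) (fun k => hrn _ _)
      have hsplit : monomial (D 1 + e') (1 : K) = monomial e' 1 * hminor K n ρ γ -
          ∑ σ ∈ Finset.univ.erase (1 : Equiv.Perm (Fin (r+1))),
            Equiv.Perm.sign σ • monomial (D σ + e') (1 : K) := by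
        rw [hdet, ← Finset.add_sum_erase _ _ (Finset.mem_univ (1 : Equiv.Perm (Fin (r+1)))),
          mul_add, Finset.mul_sum]
        have : ∀ σ : Equiv.Perm (Fin (r+1)), monomial e' (1:K) *
            (Equiv.Perm.sign σ • monomial (D σ) (1 : K)) =
            Equiv.Perm.sign σ • monomial (D σ + e') (1 : K) := by
          intro σ
          rw [mul_smul_comm, monomial_mul, mul_one, add_comm e']
        simp only [this]
        simp
      rw [hsplit]
      refine Submodule.sub_mem _ ?_ (Submodule.sum_mem _ fun σ hσ => ?_)
      · apply Submodule.mem_sup_left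
        exact I'.mul_mem_left _ hmem'
      · have hlt : wt (D σ + e') < M := by
          rw [← he, wt_add, wt_add, wt_sum, wt_sum]
          have := mono_sum_lt ρ γ hρ hγ σ (Finset.ne_of_mem_erase hσ)
          simpa using this
        have := ih _ hlt _ rfl
        rcases Int.units_eq_one_or (Equiv.Perm.sign σ) with h | h
        · rw [h, one_smul]
          exact this
        · rw [h]
          simpa [Units.smul_def] using N.neg_mem this
  intro f hf
  have hfN : f ∈ N := by
    rw [f.as_sum]
    refine Submodule.sum_mem _ fun e _ => ?_
    have := N.smul_mem (f.coeff e) (key _ e rfl)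
    simpa [smul_monomial] using this
  obtain ⟨y, hy, z, hz, rfl⟩ := Submodule.mem_sup.1 hfN
  have hy' : y ∈ I' := hy
  have hz0 : z = 0 := by
    refine degen_standard hb z ?_ (fun e he => ((mem_restrictSupport_iff K).1 hz) he)
    have := (hJ K n r a b).sub_mem hf hy'.2
    simpa using this
  rw [hz0, add_zero]
  exact hy'.1

lemma chain_gap {t : ℕ} (c : Fin t → ℕ) (hc : ∀ i j, i < j → c i + 2 ≤ c j) :
    ∀ (d : ℕ) (i j : Fin t), j.1 = i.1 + d → c i + 2 * d ≤ c j := by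
  intro d
  induction d with
  | zero =>
    intro i j h
    have : i = j := Fin.ext (by omega)
    simp [this]
  | succ d ih =>
    intro i j h
    have h1 := ih i ⟨i.1 + d, by omega⟩ rfl
    have h2 := hc ⟨i.1 + d, by omega⟩ j (Fin.lt_def.2 (by simp only; omega))
    omega

lemma chain_gap' {t : ℕ} (c : Fin t → ℕ) (hc : ∀ i j, i < j → c i + 2 ≤ c j)
    (i j : Fin t) (h : i.1 ≤ j.1) : c i + 2 * j.1 ≤ c j + 2 * i.1 := by
  have := chain_gap c hc (j.1 - i.1) i j (by omega)
  omega

lemma hJ_le_of_max {r a b : ℕ} (hb : b < n) (I : Ideal (MvPolynomial (Fin n) K))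
    (hI : ∀ γ : Fin (r+1) → ℕ, (∀ j, a ≤ γ j ∧ γ j + r ≤ b) →
      hminor K n (fun i => i.1) γ ∈ I) : hJ K n r a b ≤ I := by
  refine hJ_le_of_chains hb I fun c hc hc2 => ?_
  have h0 : ∀ j : Fin (r+1), a + 2 * j.1 ≤ c j := by
    intro j
    have := chain_gap' c hc2 0 j (Nat.zero_le _)
    have h1 := (hc 0).1
    simp only [Fin.val_zero] at this
    omega
  refine ⟨fun i => i.1, fun k => c k - k.1, fun i j h => h, ?_, ?_, hI _ ?_⟩
  · intro i j h
    have h1 := chain_gap' c hc2 i j (le_of_lt h)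
    have h2 := h0 i
    have h3 := h0 j
    have h4 : i.1 < j.1 := h
    dsimp only
    omega
  · intro k
    have := h0 k
    dsimp only
    omega
  · intro j
    have h1 := chain_gap' c hc2 j (Fin.last r) (Fin.le_last j)
    have h2 := h0 j
    have h3 := (hc (Fin.last r)).2
    have h4 := j.2
    simp only [Fin.val_last] at h1
    omega

lemma hJ_mono {r a b a' b' : ℕ} (ha : a' ≤ a) (hb : b ≤ b') (hb' : b' < n) :
    hJ K n r a b ≤ hJ K n r a' b' := by
  refine hJ_le_of_max (by omega) _ fun γ hγ => hminor_mem hb' _ _ fun i j => ?_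
  have := hγ j
  have := i.2
  omega

lemma hJ_left {r a b : ℕ} (hb : b < n) : hJ K n (r+1) a b ≤ hJ K n r (a+1) b := by
  refine hJ_le_of_max hb _ fun γ hγ => ?_
  rw [hminor, Matrix.det_succ_row_zero]
  refine Ideal.sum_mem _ fun j _ => Ideal.mul_mem_left _ _ ?_
  refine hminor_mem hb (fun i => i.succ.1) (fun k => γ (j.succAbove k)) fun i k => ?_
  have := hγ (j.succAbove k)
  have := i.2
  simp only [Fin.val_succ]
  omega

lemma hJ_right {r a b : ℕ} (hb : b < n) : hJ K n (r+1) a b ≤ hJ K n r a (b-1) := by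
  refine hJ_le_of_max hb _ fun γ hγ => ?_
  rw [hminor, Matrix.det_succ_row _ (Fin.last (r+1))]
  refine Ideal.sum_mem _ fun j _ => Ideal.mul_mem_left _ _ ?_
  refine hminor_mem (by omega) (fun i => ((Fin.last (r+1)).succAbove i).1)
    (fun k => γ (j.succAbove k)) fun i k => ?_
  have := hγ (j.succAbove k)
  have := i.2
  simp only [Fin.succAbove_last, Fin.val_castSucc]
  omega

lemma vec_det_mem {R : Type*} [CommRing R] {s : ℕ} (I : Ideal R) (M : Matrix (Fin s) (Fin s) R)
    (c : Fin s → R) (h : ∀ j, ∑ k, c k * M k j ∈ I) (k : Fin s) : c k * M.det ∈ I := by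
  have h1 : c k * M.det = ∑ j, (∑ l, c l * M l j) * M.adjugate j k := by
    have h2 : Matrix.vecMul (Matrix.vecMul c M) M.adjugate = Matrix.vecMul c (M.det • 1) := by
      rw [Matrix.vecMul_vecMul, Matrix.mul_adjugate]
    have h3 := congrFun h2 k
    rw [Matrix.vecMul_smul, Matrix.vecMul_one, Pi.smul_apply, smul_eq_mul] at h3
    rw [mul_comm, ← h3]
    rfl
  rw [h1]
  exact Ideal.sum_mem _ fun j _ => Ideal.mul_mem_right _ _ (h j)

/-- Signed cofactors of a `(p+1) × p` Hankel matrix with columns `l`. -/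
noncomputable def hcof (K : Type*) [Field K] (n : ℕ) {p : ℕ} (l : Fin p → ℕ) (k : Fin (p+1)) :
    MvPolynomial (Fin n) K :=
  (-1) ^ k.1 * hminor K n (fun i => (k.succAbove i).1) l

lemma hcof_sum {p : ℕ} (l : Fin p → ℕ) (j : ℕ) :
    ∑ k : Fin (p+1), hcof K n l k * hx K n (k.1 + j) =
      hminor K n (fun i => i.1) (Fin.cons j l : Fin (p+1) → ℕ) := by
  rw [hminor, Matrix.det_succ_column_zero]
  refine Finset.sum_congr rfl fun k _ => ?_
  rw [hcof, hminor]
  simp only [Matrix.of_apply, Fin.cons_zero]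
  have : (Matrix.of fun i j' : Fin (p+1) => hx K n (i.1 + (Fin.cons j l : Fin (p+1) → ℕ) j')).submatrix
      k.succAbove Fin.succ = Matrix.of fun i j => hx K n ((k.succAbove i).1 + l j) := by
    ext1 i j
    simp
  rw [this]
  ring

lemma hminor_eval (P : ℕ → K) {t : ℕ} (ρ γ : Fin t → ℕ) (h : ∀ i j, ρ i + γ j < n) :
    eval (fun i : Fin n => P i.1) (hminor K n ρ γ) =
      Matrix.det (Matrix.of fun i j => P (ρ i + γ j)) := by
  rw [hminor, RingHom.map_det]
  congr 1
  ext1 i j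
  simp [hx_eq (h i j)]

lemma det_inj_ne_zero {t : ℕ} (f : Fin t → Fin t) (hf : Function.Injective f)
    (M : Matrix (Fin t) (Fin t) K) (hM : ∀ i j, M i j = if f i = j then 1 else 0) :
    M.det ≠ 0 := by
  have h1 : M = (1 : Matrix (Fin t) (Fin t) K).submatrix
      (Equiv.ofBijective f (Finite.injective_iff_bijective.1 hf)) id := by
    ext i j
    rw [hM]
    simp [Matrix.one_apply]
  rw [h1, Matrix.det_permute, Matrix.det_one, mul_one]
  rcases Int.units_eq_one_or (Equiv.Perm.sign
    (Equiv.ofBijective f (Finite.injective_iff_bijective.1 hf))) with h | h <;> simp [h]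

/-- Anti-diagonal permutation matrices are invertible. -/
lemma det_anti_ne_zero {t : ℕ} (M : Matrix (Fin t) (Fin t) K)
    (hM : ∀ i j, M i j = if i.1 + j.1 + 1 = t then 1 else 0) : M.det ≠ 0 := by
  refine det_inj_ne_zero Fin.rev Fin.rev_injective M fun i j => ?_
  rw [hM]
  refine if_congr ?_ rfl rfl
  rw [Fin.ext_iff, Fin.val_rev]
  have := i.2
  omega

lemma hcof_not_mem {p : ℕ} {J : Ideal (MvPolynomial (Fin n) K)} (l : Fin p → ℕ) (k : Fin (p+1))
    (h : hminor K n (fun i => (k.succAbove i).1) l ∉ J) : hcof K n l k ∉ J := by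
  intro h1
  apply h
  have := J.mul_mem_left ((-1) ^ k.1) h1
  rw [hcof, ← mul_assoc, ← mul_pow] at this
  simpa using this

lemma not_mem_of_eval {J : Ideal (MvPolynomial (Fin n) K)} (P : ℕ → K)
    (hJ : J ≤ RingHom.ker (eval (fun i : Fin n => P i.1))) (d : MvPolynomial (Fin n) K)
    (hd : eval (fun i : Fin n => P i.1) d ≠ 0) : d ∉ J := fun h => hd (hJ h)

lemma kf_colon {f d : MvPolynomial (Fin n) K} {I J : Ideal (MvPolynomial (Fin n) K)}
    (hI : KnutsonFamily f I) (hIJ : I ≤ J) (hp : J.IsPrime) (hd : d ∉ J)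
    (h : J ≤ I.colon (Ideal.span {d} : Ideal (MvPolynomial (Fin n) K))) : KnutsonFamily f J := by
  have : J = I.colon (Ideal.span {d} : Ideal (MvPolynomial (Fin n) K)) := by
    refine le_antisymm h fun x hx => ?_
    have h1 := Submodule.mem_colon.1 hx d (Ideal.mem_span_singleton_self d)
    exact (hp.mem_or_mem (hIJ h1)).resolve_right hd
  rw [this]
  exact KnutsonFamily.colon _ _ hI

lemma mem_colon_of {d x : MvPolynomial (Fin n) K} {I : Ideal (MvPolynomial (Fin n) K)}
    (h : d * x ∈ I) : x ∈ I.colon (Ideal.span {d} : Ideal (MvPolynomial (Fin n) K)) := by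
  rw [Submodule.mem_colon]
  intro s hs
  obtain ⟨y, rfl⟩ := Ideal.mem_span_singleton'.1 hs
  have := I.mul_mem_left y h
  rw [smul_eq_mul]
  convert this using 1
  ring

lemma step_C {p : ℕ} (hn : 2 * p + 3 ≤ n) {f : MvPolynomial (Fin n) K}
    (hA : KnutsonFamily f (hJ K n (p+1) 0 (n-1))) (hB : KnutsonFamily f (hJ K n p 1 (n-2))) :
    KnutsonFamily f (hJ K n p 0 (n-2)) := by
  set l : Fin (p+1) → ℕ := fun j => n - 2 * p - 2 + j.1 with hl
  refine kf_colon (d := hcof K n l 0) (KnutsonFamily.add _ _ hA hB) ?_ (hJ_prime _ _ _) ?_ ?_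
  · refine sup_le ?_ (hJ_mono (by omega) le_rfl (by omega))
    exact hJ_right (by omega)
  · apply hcof_not_mem
    refine not_mem_of_eval (fun i => if i = n - p - 1 then 1 else 0) ?_ _ ?_
    · refine hJ_le_of_max (by omega) _ fun γ hγ => ?_
      rw [RingHom.mem_ker, hminor_eval (fun i => if i = n - p - 1 then 1 else 0)]
      · apply Matrix.det_eq_zero_of_row_eq_zero 0
        intro j
        have := hγ j
        simp only [Matrix.of_apply]
        refine if_neg ?_
        have h0 : ((0 : Fin (p+1)) : ℕ) = 0 := rfl
        omega
      · intro i j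
        have := hγ j
        have := i.2
        omega
    · rw [hminor_eval (fun i => if i = n - p - 1 then 1 else 0)]
      · apply det_anti_ne_zero
        intro i j
        have := i.2
        have := j.2
        simp only [Matrix.of_apply, Fin.zero_succAbove, Fin.val_succ, hl]
        refine if_congr ?_ rfl rfl
        omega
      · intro i j
        have := i.2
        have := j.2
        simp only [Fin.zero_succAbove, Fin.val_succ, hl]
        omega
  · refine hJ_le_of_max (by omega) _ fun γ hγ => mem_colon_of ?_
    refine vec_det_mem _ _ (fun k => hcof K n l k.castSucc) (fun j => ?_) 0
    have h1 : hminor K n (fun i => i.1) (Fin.cons (γ j) l : Fin (p+1+1) → ℕ) ∈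
        hJ K n (p+1) 0 (n-1) := by
      refine hminor_mem (by omega) _ _ fun i k => ⟨Nat.zero_le _, ?_⟩
      have := i.2
      have := hγ j
      refine Fin.cases ?_ (fun k => ?_) k
      · simp only [Fin.cons_zero]
        omega
      · have := k.2
        simp only [Fin.cons_succ, hl]
        omega
    have h2 : hcof K n l (Fin.last (p+1)) ∈ hJ K n p 1 (n-2) := by
      refine Ideal.mul_mem_left _ _ (hminor_mem (by omega) _ _ fun i k => ?_)
      have := i.2
      have := k.2
      simp only [Fin.succAbove_last, Fin.val_castSucc, hl]
      omega
    rw [← hcof_sum, Fin.sum_univ_castSucc] at h1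
    have h3 := Submodule.mem_sup_left (T := hJ K n p 1 (n-2)) h1
    have h4 := Submodule.mem_sup_right (S := hJ K n (p+1) 0 (n-1))
      ((hJ K n p 1 (n-2)).mul_mem_right (hx K n ((Fin.last (p+1)).1 + γ j)) h2)
    have h5 := Submodule.sub_mem _ h3 h4
    rw [add_sub_cancel_right] at h5
    exact h5

lemma step_D {p : ℕ} (hn : 2 * p + 3 ≤ n) {f : MvPolynomial (Fin n) K}
    (hA : KnutsonFamily f (hJ K n (p+1) 0 (n-1))) (hB : KnutsonFamily f (hJ K n p 1 (n-2))) :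
    KnutsonFamily f (hJ K n p 1 (n-1)) := by
  set l : Fin (p+1) → ℕ := fun j => j.1 with hl
  refine kf_colon (d := hcof K n l (Fin.last (p+1))) (KnutsonFamily.add _ _ hA hB) ?_
    (hJ_prime _ _ _) ?_ ?_
  · refine sup_le ?_ (hJ_mono le_rfl (by omega) (by omega))
    exact hJ_left (by omega)
  · apply hcof_not_mem
    refine not_mem_of_eval (fun i => if i = p then 1 else 0) ?_ _ ?_
    · refine hJ_le_of_max (by omega) _ fun γ hγ => ?_
      rw [RingHom.mem_ker, hminor_eval (fun i => if i = p then 1 else 0)]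
      · apply Matrix.det_eq_zero_of_row_eq_zero (Fin.last p)
        intro j
        have := hγ j
        simp only [Matrix.of_apply, Fin.val_last]
        rw [if_neg]
        omega
      · intro i j
        have := hγ j
        have := i.2
        omega
    · rw [hminor_eval (fun i => if i = p then 1 else 0)]
      · apply det_anti_ne_zero
        intro i j
        have := i.2
        have := j.2
        simp only [Matrix.of_apply, Fin.succAbove_last, Fin.val_castSucc, hl]
        refine if_congr ?_ rfl rfl
        omega
      · intro i j
        have := i.2
        have := j.2
        simp only [Fin.succAbove_last, Fin.val_castSucc, hl]
        omega
  · refine hJ_le_of_max (by omega) _ fun γ hγ => mem_colon_of ?_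
    refine vec_det_mem _ _ (fun k => hcof K n l k.succ) (fun j => ?_) (Fin.last p)
    have h1 : hminor K n (fun i => i.1) (Fin.cons (γ j - 1) l : Fin (p+1+1) → ℕ) ∈
        hJ K n (p+1) 0 (n-1) := by
      refine hminor_mem (by omega) _ _ fun i k => ⟨Nat.zero_le _, ?_⟩
      have := i.2
      have := hγ j
      refine Fin.cases ?_ (fun k => ?_) k
      · simp only [Fin.cons_zero]
        omega
      · have := k.2
        simp only [Fin.cons_succ, hl]
        omega
    have h2 : hcof K n l 0 ∈ hJ K n p 1 (n-2) := by
      refine Ideal.mul_mem_left _ _ (hminor_mem (by omega) _ _ fun i k => ?_)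
      have := i.2
      have := k.2
      simp only [Fin.zero_succAbove, Fin.val_succ, hl]
      omega
    rw [← hcof_sum, Fin.sum_univ_succ] at h1
    have h3 := Submodule.mem_sup_left (T := hJ K n p 1 (n-2)) h1
    have h4 := Submodule.mem_sup_right (S := hJ K n (p+1) 0 (n-1))
      ((hJ K n p 1 (n-2)).mul_mem_right (hx K n ((0 : Fin (p+1+1)).1 + (γ j - 1))) h2)
    have h5 := Submodule.sub_mem _ h3 h4
    rw [add_sub_cancel_left] at h5
    have e : ∀ k : ℕ, k + 1 + (γ j - 1) = k + γ j := fun k => by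
      have := (hγ j).1
      omega
    simp only [Fin.val_succ, e] at h5
    exact h5

lemma cof_CD {p : ℕ} (hn : 2 * p + 3 ≤ n) (l : Fin p → ℕ)
    (hl : ∀ j, 1 ≤ l j ∧ l j + p + 2 ≤ n) (E : Fin (p+1) → ℕ) (hE : ∀ j, E j + p + 1 ≤ n)
    (k : Fin (p+1)) :
    hcof K n l k * hminor K n (fun i => i.1) E ∈ hJ K n p 0 (n-2) + hJ K n p 1 (n-1) := by
  refine vec_det_mem _ _ (hcof K n l) (fun j => ?_) k
  simp only [Matrix.of_apply]
  rw [hcof_sum]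
  have h1 := hE j
  by_cases h : E j + p + 2 ≤ n
  · refine Submodule.mem_sup_left (hminor_mem (by omega) _ _ fun i q => ⟨Nat.zero_le _, ?_⟩)
    have := i.2
    refine Fin.cases ?_ (fun q => ?_) q
    · simp only [Fin.cons_zero]
      omega
    · have := hl q
      simp only [Fin.cons_succ]
      omega
  · refine Submodule.mem_sup_right (hminor_mem (by omega) _ _ fun i q => ?_)
    have := i.2
    refine Fin.cases ?_ (fun q => ?_) q
    · simp only [Fin.cons_zero]
      omega
    · have := hl q
      simp only [Fin.cons_succ]
      omega

lemma step_A {p : ℕ} (hn : 2 * p + 3 ≤ n) {f : MvPolynomial (Fin n) K}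
    (hC : KnutsonFamily f (hJ K n p 0 (n-2))) (hD : KnutsonFamily f (hJ K n p 1 (n-1))) :
    KnutsonFamily f (hJ K n p 0 (n-1)) := by
  set l : Fin p → ℕ := fun j => j.1 + 1 with hl
  refine kf_colon (d := hcof K n l (Fin.last p)) (KnutsonFamily.add _ _ hC hD) ?_
    (hJ_prime _ _ _) ?_ ?_
  · exact sup_le (hJ_mono le_rfl (by omega) (by omega)) (hJ_mono (by omega) le_rfl (by omega))
  · apply hcof_not_mem
    refine not_mem_of_eval (fun i => if p ≠ 0 ∧ p ∣ i then 1 else 0) ?_ _ ?_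
    · refine hJ_le_of_max (by omega) _ fun γ hγ => ?_
      rw [RingHom.mem_ker, hminor_eval (fun i => if p ≠ 0 ∧ p ∣ i then 1 else 0)]
      · rcases Nat.eq_zero_or_pos p with rfl | hp
        · apply Matrix.det_eq_zero_of_row_eq_zero 0
          intro j
          simp
        · apply Matrix.det_zero_of_row_eq (i := 0) (j := Fin.last p)
          · intro h
            have := Fin.ext_iff.1 h
            simp only [Fin.val_zero, Fin.val_last] at this
            omega
          · funext j
            simp
      · intro i j
        have := hγ j
        have := i.2
        omega
    · rw [hminor_eval (fun i => if p ≠ 0 ∧ p ∣ i then 1 else 0)]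
      · apply det_anti_ne_zero
        intro i j
        have h1 := i.2
        have h2 := j.2
        simp only [Matrix.of_apply, Fin.succAbove_last, Fin.val_castSucc, hl]
        refine if_congr ?_ rfl rfl
        constructor
        · rintro ⟨_, q, hq⟩
          have h3 : p * q < p * 2 := by omega
          have h4 : q < 2 := lt_of_mul_lt_mul_left h3 (Nat.zero_le _)
          interval_cases q <;> omega
        · intro h
          refine ⟨by omega, 1, by omega⟩
      · intro i j
        have := i.2
        have := j.2
        simp only [Fin.succAbove_last, Fin.val_castSucc, hl]
        omega
  · refine hJ_le_of_max (by omega) _ fun γ hγ => mem_colon_of ?_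
    refine cof_CD hn l (fun j => ?_) γ (fun j => ?_) _
    · have := j.2
      simp only [hl]
      omega
    · have := hγ j
      omega

lemma step_B {q : ℕ} (hn : 2 * (q + 1) + 3 ≤ n) {f : MvPolynomial (Fin n) K}
    (hC : KnutsonFamily f (hJ K n (q+1) 0 (n-2))) (hD : KnutsonFamily f (hJ K n (q+1) 1 (n-1))) :
    KnutsonFamily f (hJ K n q 1 (n-2)) := by
  set E : Fin (q+1+1) → ℕ := fun j => if j.1 < q + 1 then j.1 else n - 2 - q with hE
  have hE1 : ∀ j, E j + (q + 1) + 1 ≤ n := by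
    intro j
    simp only [hE]
    split_ifs <;> omega
  refine kf_colon (d := hminor K n (fun i => i.1) E) (KnutsonFamily.add _ _ hC hD) ?_
    (hJ_prime _ _ _) ?_ ?_
  · exact sup_le (hJ_left (by omega)) (hJ_right (by omega))
  · refine not_mem_of_eval (fun i => if i = q ∨ i = n - 1 then 1 else 0) ?_ _ ?_
    · refine hJ_le_of_max (by omega) _ fun γ hγ => ?_
      rw [RingHom.mem_ker, hminor_eval (fun i => if i = q ∨ i = n - 1 then 1 else 0)]
      · apply Matrix.det_eq_zero_of_row_eq_zero (Fin.last q)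
        intro j
        have := hγ j
        simp only [Matrix.of_apply, Fin.val_last]
        rw [if_neg]
        omega
      · intro i j
        have := hγ j
        have := i.2
        omega
    · rw [hminor_eval (fun i => if i = q ∨ i = n - 1 then 1 else 0)]
      · refine det_inj_ne_zero (fun i => if h : i.1 < q + 1 then ⟨q - i.1, by omega⟩ else i) ?_ _ ?_
        · intro i j hij
          have h1 := i.2
          have h2 := j.2
          dsimp only at hij
          ext
          split_ifs at hij <;> simp only [Fin.ext_iff] at hij <;> omega
        · intro i j
          have h1 := i.2
          have h2 := j.2
          simp only [Matrix.of_apply, hE]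
          refine if_congr ?_ rfl rfl
          split_ifs <;> simp only [Fin.ext_iff] <;> omega
      · intro i j
        have := i.2
        have := hE1 j
        omega
  · refine hJ_le_of_chains (by omega) _ fun c hc hc2 => ?_
    have h0 : ∀ j : Fin (q+1), 2 * j.1 + 1 ≤ c j := by
      intro j
      have := chain_gap' c hc2 0 j (Nat.zero_le _)
      have h1 := (hc 0).1
      simp only [Fin.val_zero] at this
      omega
    have h00 : ∀ j : Fin (q+1), c j + 2 * q ≤ n - 2 + 2 * j.1 := by
      intro j
      have := chain_gap' c hc2 j (Fin.last q) (Fin.le_last j)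
      have h1 := (hc (Fin.last q)).2
      simp only [Fin.val_last] at this
      omega
    have hex : ∃ s : ℕ, ∀ h : s < q + 1, c ⟨s, h⟩ ≠ 2 * s + 1 := ⟨q + 1, fun h => by omega⟩
    classical
    obtain ⟨s, hs, hsmin⟩ : ∃ s : ℕ, (∀ h : s < q + 1, c ⟨s, h⟩ ≠ 2 * s + 1) ∧
        ∀ s' < s, ¬ ∀ h : s' < q + 1, c ⟨s', h⟩ ≠ 2 * s' + 1 :=
      ⟨Nat.find hex, Nat.find_spec hex, fun s' h => Nat.find_min hex h⟩
    have hsq : s ≤ q + 1 := by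
      by_contra h
      exact hsmin (q+1) (by omega) (fun h => by omega)
    have hlow : ∀ j : Fin (q+1), j.1 < s → c j = 2 * j.1 + 1 := by
      intro j hj
      have := hsmin j.1 hj
      push Not at this
      obtain ⟨_, h⟩ := this
      exact h
    have hhigh : ∀ j : Fin (q+1), s ≤ j.1 → 2 * j.1 + 2 ≤ c j := by
      intro j hj
      have h1 := chain_gap' c hc2 ⟨s, by have := j.2; omega⟩ j hj
      have h2 := hs (by have := j.2; omega)
      have h3 := h0 ⟨s, by have := j.2; omega⟩
      simp only at h1 h3
      omega
    set k : Fin (q+1+1) := ⟨s, by omega⟩ with hk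
    have hsA : ∀ j : Fin (q+1), (k.succAbove j).1 = if j.1 < s then j.1 else j.1 + 1 := by
      intro j
      simp only [Fin.succAbove, hk, Fin.lt_def, Fin.val_castSucc]
      split_ifs <;> simp
    have hγ : ∀ j : Fin (q+1), (k.succAbove j).1 ≤ c j ∧ j.1 + 1 + (k.succAbove j).1 ≤ c j ∧
        c j + q + 3 ≤ n + (k.succAbove j).1 := by
      intro j
      have := h0 j
      have := h00 j
      have := j.2
      rw [hsA]
      split_ifs with h
      · have := hlow j h
        omega
      · have := hhigh j (by omega)
        omega
    refine ⟨fun j => (k.succAbove j).1, fun j => c j - (k.succAbove j).1, ?_, ?_, ?_, ?_⟩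
    · intro i j hij
      exact Fin.strictMono_succAbove k hij
    · intro i j hij
      have h1 := chain_gap' c hc2 i j (le_of_lt hij)
      have h2 : i.1 < j.1 := hij
      have h3 := hγ i
      have h4 := hγ j
      dsimp only
      by_cases hi : i.1 < s
      · have h5 := hlow i hi
        have h6 := hsA i
        rw [if_pos hi] at h6
        omega
      · have h5 := hsA i
        have h6 := hsA j
        rw [if_neg hi] at h5
        rw [if_neg (by omega)] at h6
        omega
    · intro j
      have := hγ j
      dsimp only
      omega
    · apply mem_colon_of
      have h1 := cof_CD (K := K) hn (fun j => c j - (k.succAbove j).1) (fun j => by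
        have := hγ j
        omega) E hE1 k
      have h2 := Ideal.mul_mem_left _ ((-1) ^ k.1) h1
      rw [hcof, ← mul_assoc, ← mul_assoc, ← mul_pow] at h2
      simp only [neg_mul, one_mul, neg_neg, one_pow] at h2
      rw [mul_comm]
      exact h2

lemma hankelX_apply (m : ℕ) (i j : Fin m) :
    hankelX K m i j = hx K (2 * m - 1) (i.1 + j.1) := by
  have := i.2
  have := j.2
  rw [hx_eq (by omega)]
  rfl

lemma hankelQ_apply (m : ℕ) (i j : Fin (m - 1)) :
    hankelQ K m i j = hx K (2 * m - 1) (i.1 + (j.1 + 1)) := by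
  have := i.2
  have := j.2
  rw [hx_eq (by omega)]
  rfl

lemma hankelX_sub_det {t m : ℕ} (ρ γ : Fin t → Fin m) :
    ((hankelX K m).submatrix ρ γ).det =
      hminor K (2 * m - 1) (fun i => (ρ i).1) (fun i => (γ i).1) := by
  unfold hminor
  congr 1
  ext1 i j
  simp [hankelX_apply]

lemma hankelQ_det (m : ℕ) :
    (hankelQ K m).det = hminor K (2 * m - 1) (fun i : Fin (m - 1) => i.1) (fun i => i.1 + 1) := by
  unfold hminor
  congr 1
  ext1 i j
  simp [hankelQ_apply]

lemma minorsIdeal_eq {t m : ℕ} (ht : t + 1 ≤ m) :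
    minorsIdeal (t + 1) (hankelX K m) = hJ K (2 * m - 1) t 0 (2 * m - 1 - 1) := by
  apply le_antisymm
  · refine Ideal.span_le.2 ?_
    rintro d ⟨ρ, γ, -, -, rfl⟩
    rw [hankelX_sub_det]
    refine hminor_mem (by omega) _ _ fun i j => ⟨Nat.zero_le _, ?_⟩
    have := (ρ i).2
    have := (γ j).2
    omega
  · refine hJ_le_of_chains (by omega) _ fun c hc hc2 => ?_
    refine ⟨fun k => c k / 2, fun k => c k - c k / 2, ?_, ?_, ?_, ?_⟩
    · intro i j hij
      have := hc2 i j hij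
      dsimp only
      omega
    · intro i j hij
      have := hc2 i j hij
      dsimp only
      omega
    · intro k
      dsimp only
      omega
    · refine Ideal.subset_span ⟨fun k => ⟨c k / 2, ?_⟩, fun k => ⟨c k - c k / 2, ?_⟩, ?_, ?_, ?_⟩
      · have := hc k
        omega
      · have := hc k
        omega
      · intro i j hij
        have := hc2 i j hij
        rw [Fin.lt_def]
        dsimp only
        omega
      · intro i j hij
        have := hc2 i j hij
        rw [Fin.lt_def]
        dsimp only
        omega
      · rw [hankelX_sub_det]

lemma span_detX {m : ℕ} (hm : 1 ≤ m) :
    hJ K (2 * m - 1) (m - 1) 0 (2 * m - 1 - 1) = Ideal.span {(hankelX K m).det} := by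
  obtain ⟨p, rfl⟩ : ∃ p, m = p + 1 := ⟨m - 1, by omega⟩
  have h := hankelX_sub_det (K := K) (id : Fin (p+1) → Fin (p+1)) id
  rw [Matrix.submatrix_id_id] at h
  rw [h]
  simp only [Nat.add_sub_cancel]
  apply le_antisymm
  · refine hJ_le_of_chains (by omega) _ fun c hc hc2 => ?_
    have hc3 : ∀ j : Fin (p+1), c j = 2 * j.1 := by
      intro j
      have h1 := chain_gap' c hc2 0 j (Nat.zero_le _)
      have h2 := chain_gap' c hc2 j (Fin.last p) (Fin.le_last j)
      have h3 := (hc (Fin.last p)).2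
      simp only [Fin.val_last, Fin.val_zero] at h1 h2
      omega
    refine ⟨fun i => i.1, fun i => i.1, fun i j h => h, fun i j h => h, fun k => ?_, ?_⟩
    · rw [hc3]
      ring
    · exact Ideal.mem_span_singleton_self _
  · rw [Ideal.span_singleton_le_iff_mem]
    refine hminor_mem (by omega) _ _ fun i j => ⟨Nat.zero_le _, ?_⟩
    have := i.2
    have := j.2
    simp only [id]
    omega

lemma span_detQ {m : ℕ} (hm : 2 ≤ m) :
    hJ K (2 * m - 1) (m - 2) 1 (2 * m - 1 - 2) = Ideal.span {(hankelQ K m).det} := by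
  obtain ⟨p, rfl⟩ : ∃ p, m = p + 1 + 1 := ⟨m - 2, by omega⟩
  have h := hankelQ_det (K := K) (p + 1 + 1)
  rw [h]
  change hJ K (2 * (p + 1 + 1) - 1) p 1 _ = Ideal.span {hminor K (2 * (p + 1 + 1) - 1)
    (fun i : Fin (p + 1) => i.1) (fun i => i.1 + 1)}
  apply le_antisymm
  · refine hJ_le_of_chains (by omega) _ fun c hc hc2 => ?_
    have hc3 : ∀ j : Fin (p+1), c j = 2 * j.1 + 1 := by
      intro j
      have h1 := chain_gap' c hc2 0 j (Nat.zero_le _)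
      have h2 := chain_gap' c hc2 j (Fin.last p) (Fin.le_last j)
      have h3 := (hc (Fin.last p)).2
      have h4 := (hc 0).1
      simp only [Fin.val_last, Fin.val_zero] at h1 h2
      omega
    refine ⟨fun i => i.1, fun i => i.1 + 1, fun i j h => h, fun i j h => Nat.succ_lt_succ h,
      fun k => ?_, ?_⟩
    · rw [hc3]
      ring
    · exact Ideal.mem_span_singleton_self _
  · rw [Ideal.span_singleton_le_iff_mem]
    refine hminor_mem (by omega) _ _ fun i j => ?_
    have := i.2
    have := j.2
    omega

lemma kf_descend {m : ℕ} (hm : 1 ≤ m) {f : MvPolynomial (Fin (2 * m - 1)) K}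
    (hX : KnutsonFamily f (hJ K (2 * m - 1) (m - 1) 0 (2 * m - 1 - 1)))
    (hQ : 2 ≤ m → KnutsonFamily f (hJ K (2 * m - 1) (m - 2) 1 (2 * m - 1 - 2))) (d : ℕ) :
    d ≤ m - 1 → KnutsonFamily f (hJ K (2 * m - 1) (m - 1 - d) 0 (2 * m - 1 - 1)) ∧
      (d + 2 ≤ m → KnutsonFamily f (hJ K (2 * m - 1) (m - 2 - d) 1 (2 * m - 1 - 2))) := by
  induction d with
  | zero => exact fun _ => ⟨hX, fun h => hQ (by omega)⟩
  | succ d ih =>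
    intro hd
    obtain ⟨p, hp⟩ : ∃ p, m = p + d + 2 := ⟨m - d - 2, by omega⟩
    obtain ⟨h1, h2⟩ := ih (by omega)
    have h2 := h2 (by omega)
    rw [show m - 1 - d = p + 1 by omega] at h1
    rw [show m - 2 - d = p by omega] at h2
    rw [show m - 1 - (d + 1) = p by omega]
    have hn : 2 * p + 3 ≤ 2 * m - 1 := by omega
    have hC := step_C hn h1 h2
    have hD := step_D hn h1 h2
    refine ⟨step_A hn hC hD, fun h => ?_⟩
    obtain ⟨q, rfl⟩ : ∃ q, p = q + 1 := ⟨p - 1, by omega⟩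
    rw [show m - 2 - (d + 1) = q by omega]
    exact step_B hn hC hD

lemma kf_factor {σ : Type*} (a b : MvPolynomial σ K) (hb : b ≠ 0) :
    KnutsonFamily (a * b) (Ideal.span {a}) := by
  have h := KnutsonFamily.colon _ (Ideal.span {b}) (KnutsonFamily.base (f := a * b))
  convert h using 1
  ext x
  rw [Submodule.mem_colon]
  constructor
  · intro hx p hp
    obtain ⟨y, rfl⟩ := Ideal.mem_span_singleton'.1 hx
    obtain ⟨z, rfl⟩ := Ideal.mem_span_singleton'.1 hp
    exact Ideal.mem_span_singleton'.2 ⟨y * z, by simp only [smul_eq_mul]; ring⟩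
  · intro hx
    have := hx b (Ideal.mem_span_singleton_self b)
    obtain ⟨y, hy⟩ := Ideal.mem_span_singleton'.1 this
    refine Ideal.mem_span_singleton'.2 ⟨y, mul_right_cancel₀ hb ?_⟩
    rw [mul_assoc, hy, smul_eq_mul]

lemma leadTerm_mul' {σ : Type*} (ord : MonomialOrder σ) (f g : MvPolynomial σ K)
    (hf : f ≠ 0) (hg : g ≠ 0) :
    ord.leadTerm (f * g) = ord.leadTerm f * ord.leadTerm g := by
  change monomial (ord.degree (f * g)) (ord.leadingCoeff (f * g)) =
    monomial (ord.degree f) (ord.leadingCoeff f) * monomial (ord.degree g) (ord.leadingCoeff g)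
  rw [monomial_mul, MonomialOrder.degree_mul hf hg, MonomialOrder.leadingCoeff_mul]

lemma ne_zero_of_leadTerm {σ : Type*} (ord : MonomialOrder σ) (f : MvPolynomial σ K)
    (hf : ord.leadTerm f ≠ 0) : f ≠ 0 := by
  rintro rfl
  exact hf (by simp [MonomialOrder.leadTerm])

lemma prod_split {R : Type*} [CommMonoid R] (g : ℕ → R) (p : ℕ) :
    (∏ i ∈ range (p + 1), g (i + i)) * ∏ i ∈ range p, g (i + (i + 1)) =
      ∏ i ∈ range (2 * p + 1), g i := by
  induction p with
  | zero => simp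
  | succ p ih =>
    rw [show 2 * (p + 1) + 1 = 2 * p + 1 + 1 + 1 by ring, prod_range_succ _ (2 * p + 1 + 1),
      prod_range_succ _ (2 * p + 1), ← ih, prod_range_succ _ (p + 1),
      prod_range_succ (fun i => g (i + (i + 1))) p,
      show p + (p + 1) = 2 * p + 1 by ring, show p + 1 + (p + 1) = 2 * p + 1 + 1 by ring]
    simp only [mul_assoc, mul_comm, mul_left_comm]

end Aux

/-- **Theorem 3.2.** Let `n = 2m-1`, `X` the generic square Hankel matrix of size `m`, `Q` the
Hankel matrix obtained by dropping the last row and first column of `X`, and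
`f = det X · det Q`. With respect to a diagonal term order (one for which the leading term of
every minor of `X` is the product of its diagonal entries), `lt(f) = x₁⋯xₙ` is squarefree, and
`I_t(X) ∈ C_f` for every `t = 1, …, m`. -/
theorem hankel_minors_knutson_square {K : Type*} [Field K] (m : ℕ) (hm : 1 ≤ m)
    (ord : MonomialOrder (Fin (2 * m - 1)))
    (hdiag : ∀ (t : ℕ) (ρ γ : Fin t → Fin m), StrictMono ρ → StrictMono γ →
      ord.leadTerm ((hankelX K m).submatrix ρ γ).det = ∏ k, (hankelX K m) (ρ k) (γ k)) :
    ord.leadTerm ((hankelX K m).det * (hankelQ K m).det) = ∏ i, MvPolynomial.X i ∧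
      ∀ t : ℕ, 1 ≤ t → t ≤ m →
        KnutsonFamily ((hankelX K m).det * (hankelQ K m).det)
          (minorsIdeal t (hankelX K m)) := by
  have hX1 : ord.leadTerm (hankelX K m).det = ∏ k : Fin m, hx K (2 * m - 1) (k.1 + k.1) := by
    have h := hdiag m id id strictMono_id strictMono_id
    rw [Matrix.submatrix_id_id] at h
    rw [h]
    exact Finset.prod_congr rfl fun k _ => hankelX_apply m k k
  have hQ1 : ord.leadTerm (hankelQ K m).det =
      ∏ k : Fin (m - 1), hx K (2 * m - 1) (k.1 + (k.1 + 1)) := by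
    have h := hdiag (m - 1) (fun i => ⟨i.1, by omega⟩) (fun i => ⟨i.1 + 1, by omega⟩)
      (fun i j h => h) (fun i j h => Nat.succ_lt_succ h)
    rw [hankelX_sub_det] at h
    rw [hankelQ_det, h]
    exact Finset.prod_congr rfl fun k _ => hankelX_apply m _ _
  have hX0 : (hankelX K m).det ≠ 0 := by
    refine ne_zero_of_leadTerm ord _ ?_
    rw [hX1]
    refine Finset.prod_ne_zero_iff.2 fun k _ => ?_
    rw [hx_eq (by omega)]
    exact X_ne_zero _
  have hQ0 : (hankelQ K m).det ≠ 0 := by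
    refine ne_zero_of_leadTerm ord _ ?_
    rw [hQ1]
    refine Finset.prod_ne_zero_iff.2 fun k _ => ?_
    rw [hx_eq (by omega)]
    exact X_ne_zero _
  constructor
  · rw [leadTerm_mul' ord _ _ hX0 hQ0, hX1, hQ1]
    have h1 : ∏ i : Fin (2 * m - 1), (X i : MvPolynomial (Fin (2 * m - 1)) K) =
        ∏ i : Fin (2 * m - 1), hx K (2 * m - 1) i.1 :=
      Finset.prod_congr rfl fun i _ => (hx_eq i.2).symm
    rw [h1, Fin.prod_univ_eq_prod_range (fun i => hx K (2 * m - 1) i),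
      Fin.prod_univ_eq_prod_range (fun i => hx K (2 * m - 1) (i + i)),
      Fin.prod_univ_eq_prod_range (fun i => hx K (2 * m - 1) (i + (i + 1)))]
    have h2 := prod_split (fun i => hx K (2 * m - 1) i) (m - 1)
    rw [show 2 * (m - 1) + 1 = 2 * m - 1 by omega, show m - 1 + 1 = m by omega] at h2
    exact h2
  · intro t ht htm
    obtain ⟨s, rfl⟩ : ∃ s, t = s + 1 := ⟨t - 1, by omega⟩
    rw [minorsIdeal_eq htm]
    have h := (kf_descend hm (f := (hankelX K m).det * (hankelQ K m).det) ?_ ?_ (m - 1 - s)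
      (by omega)).1
    · rw [show m - 1 - (m - 1 - s) = s by omega] at h
      exact h
    · rw [span_detX hm]
      exact kf_factor _ _ hQ0
    · intro h2
      rw [span_detQ h2, mul_comm (hankelX K m).det]
      exact kf_factor _ _ hX0
end
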